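/- arXiv:2010.05130 — 10 statements merged into one kernel-verified Lean document; each statement's English description precedes it below -/
import Mathlib

section
/- Fix a real parameter α > 0. If (x(t), y(t)) is a solution of Hill's lunar equations on its maximal interval of existence [0, T_max) with initial data satisfying E(Γ(0)) < E* and W(Γ(0)) > 0, then W(Γ(t)) > 0 for all t ∈ [0, T_max); likewise, if E(Γ(0)) < E* and W(Γ(0)) ≤ 0, then W(Γ(t)) ≤ 0 for all t ∈ [0, T_max). That is, the sets 𝒲₊ = {Γ ∈ ℝ⁴ : E(Γ) < E*, W(Γ) > 0} and 𝒲₋ = {Γ ∈ ℝ⁴ : E(Γ) < E*, W(Γ) ≤ 0} are invariant under the flow. -/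
open Real Set Filter Topology ENNReal

/-- r = √(x² + y²), the distance to the origin in the configuration plane. -/
noncomputable def hillR (x y : ℝ) : ℝ := Real.sqrt (x ^ 2 + y ^ 2)

/-- The effective potential V(x,y) = −((α+2)/2)x² − (α+2)/r^α. -/
noncomputable def hillV (α x y : ℝ) : ℝ :=
  -((α + 2) / 2) * x ^ 2 - (α + 2) / (hillR x y) ^ α

/-- The partial derivative V_x. -/
noncomputable def hillVx (α x y : ℝ) : ℝ :=
  -(α + 2) * x + (α + 2) * α * x / (hillR x y) ^ (α + 2)

/-- The partial derivative V_y. -/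
noncomputable def hillVy (α x y : ℝ) : ℝ :=
  (α + 2) * α * y / (hillR x y) ^ (α + 2)

/-- The energy E(Γ) = ½(ẋ² + ẏ²) + V(x,y). -/
noncomputable def hillE (α x y vx vy : ℝ) : ℝ :=
  (1 / 2) * (vx ^ 2 + vy ^ 2) + hillV α x y

/-- W(Γ) = −xV_x − yV_y = (α+2)(x² − α/r^α). -/
noncomputable def hillW (α x y : ℝ) : ℝ :=
  (α + 2) * (x ^ 2 - α / (hillR x y) ^ α)

/-- K(Γ) = ẋ² + ẏ² + 2(xẏ − ẋy) + W(Γ). -/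
noncomputable def hillK (α x y vx vy : ℝ) : ℝ :=
  vx ^ 2 + vy ^ 2 + 2 * (x * vy - vx * y) + hillW α x y

/-- The ground state energy E* = −½(α+2)²α^{−α/(α+2)}. -/
noncomputable def hillEstar (α : ℝ) : ℝ :=
  -(1 / 2) * (α + 2) ^ 2 * α ^ (-(α / (α + 2)))

/-- The time interval [0, Tmax), where Tmax ∈ (0, ∞]. -/
def hillDomain (Tmax : ℝ≥0∞) : Set ℝ := {t : ℝ | 0 ≤ t ∧ ENNReal.ofReal t < Tmax}

/-- `HillSolOn α x y Tmax` : (x(t), y(t)) is a solution of Hill's lunar equations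
ẍ − 2ẏ = −V_x, ÿ + 2ẋ = −V_y avoiding the origin on the interval [0, Tmax). -/
def HillSolOn (α : ℝ) (x y : ℝ → ℝ) (Tmax : ℝ≥0∞) : Prop :=
  ∀ t ∈ hillDomain Tmax,
    (x t, y t) ≠ (0, 0) ∧
    HasDerivAt x (deriv x t) t ∧ HasDerivAt y (deriv y t) t ∧
    HasDerivAt (deriv x) (2 * deriv y t - hillVx α (x t) (y t)) t ∧
    HasDerivAt (deriv y) (-(2 * deriv x t) - hillVy α (x t) (y t)) t

/-- `HillMaxSol α x y Tmax` : (x(t), y(t)) is a solution of Hill's lunar equations on its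
maximal interval of existence [0, Tmax): no solution on a strictly larger interval extends it. -/
def HillMaxSol (α : ℝ) (x y : ℝ → ℝ) (Tmax : ℝ≥0∞) : Prop :=
  HillSolOn α x y Tmax ∧
  ∀ T' : ℝ≥0∞, Tmax < T' →
    ¬∃ x₂ y₂ : ℝ → ℝ, HillSolOn α x₂ y₂ T' ∧
      ∀ t ∈ hillDomain Tmax, x₂ t = x t ∧ y₂ t = y t

lemma hillR_pos {x y : ℝ} (h : (x, y) ≠ (0, 0)) : 0 < hillR x y := by
  unfold hillR
  apply Real.sqrt_pos.2
  by_contra hc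
  apply h
  have h1 : x ^ 2 = 0 := by nlinarith [sq_nonneg x, sq_nonneg y]
  have h2 : y ^ 2 = 0 := by nlinarith [sq_nonneg x, sq_nonneg y]
  simp only [Prod.mk.injEq]
  exact ⟨by simpa using h1, by simpa using h2⟩

lemma hillW_zero_energy {α x y : ℝ} (hα : 0 < α) (h : (x, y) ≠ (0, 0))
    (hW : hillW α x y = 0) (vx vy : ℝ) : hillEstar α ≤ hillE α x y vx vy := by
  have hr := hillR_pos h
  have hr2 : hillR x y ^ 2 = x ^ 2 + y ^ 2 := Real.sq_sqrt (by positivity)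
  unfold hillEstar hillE hillV
  unfold hillW at hW
  set r := hillR x y
  have hp : 0 < r ^ α := Real.rpow_pos_of_pos hr α
  have hx : x ^ 2 = α / r ^ α := by
    rcases mul_eq_zero.1 hW with h1 | h1 <;> linarith
  have h3 : α ≤ r ^ (α + 2) := by
    rw [Real.rpow_add hr, Real.rpow_two]
    have : α = x ^ 2 * r ^ α := by rw [hx]; field_simp
    nlinarith [mul_nonneg (sq_nonneg y) hp.le]
  have h4 : α ^ (α / (α + 2)) ≤ r ^ α := by
    have := Real.rpow_le_rpow hα.le h3 (z := α / (α + 2)) (by positivity)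
    rwa [← Real.rpow_mul hr.le, mul_div_cancel₀ _ (by positivity : α + 2 ≠ 0)] at this
  have h5 : 1 / r ^ α ≤ α ^ (-(α / (α + 2))) := by
    rw [Real.rpow_neg hα.le, ← one_div]
    exact one_div_le_one_div_of_le (Real.rpow_pos_of_pos hα _) h4
  rw [hx]
  have h6 : -((α + 2) / 2) * (α / r ^ α) - (α + 2) / r ^ α
      = -(1 / 2) * (α + 2) ^ 2 * (1 / r ^ α) := by
    field_simp; ring
  rw [h6]
  have h7 := mul_le_mul_of_nonneg_left h5 (sq_nonneg (α + 2))
  nlinarith [sq_nonneg vx, sq_nonneg vy]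

lemma hillR_rpow_deriv {α : ℝ} {x y : ℝ → ℝ} {t vx vy : ℝ} (h : (x t, y t) ≠ (0, 0))
    (hx : HasDerivAt x vx t) (hy : HasDerivAt y vy t) :
    HasDerivAt (fun s => hillR (x s) (y s) ^ α)
      (α * hillR (x t) (y t) ^ α * (x t * vx + y t * vy) / hillR (x t) (y t) ^ 2) t := by
  have hr := hillR_pos h
  have h0 : x t ^ 2 + y t ^ 2 ≠ 0 := (Real.sqrt_pos.1 hr).ne'
  have h1 : HasDerivAt (fun s => x s ^ 2 + y s ^ 2) (2 * x t * vx + 2 * y t * vy) t := by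
    have := (hx.pow 2).add (hy.pow 2)
    refine HasDerivAt.congr_deriv (f := fun s => x s ^ 2 + y s ^ 2) this ?_
    simp
  have h2 := (h1.sqrt h0).rpow_const (p := α) (Or.inl hr.ne')
  refine HasDerivAt.congr_deriv (f := fun s => hillR (x s) (y s) ^ α) h2 ?_
  symm
  change _ = _ / (2 * hillR (x t) (y t)) * α * (hillR (x t) (y t)) ^ (α - 1)
  rw [Real.rpow_sub_one hr.ne']
  field_simp

lemma hillE_deriv {α : ℝ} {x y : ℝ → ℝ} {Tmax : ℝ≥0∞} (hs : HillSolOn α x y Tmax)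
    {t : ℝ} (ht : t ∈ hillDomain Tmax) :
    HasDerivAt (fun s => hillE α (x s) (y s) (deriv x s) (deriv y s)) 0 t := by
  obtain ⟨h, hx, hy, hvx, hvy⟩ := hs t ht
  have hr := hillR_pos h
  have hp : 0 < hillR (x t) (y t) ^ α := Real.rpow_pos_of_pos hr α
  have h1 := hillR_rpow_deriv (α := α) h hx hy
  have h2 := (((hvx.pow 2).add (hvy.pow 2)).const_mul (1 / 2)).add
    (((hx.pow 2).const_mul (-((α + 2) / 2))).sub
      ((hasDerivAt_const t (α + 2)).div h1 hp.ne'))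
  refine HasDerivAt.congr_deriv (f := fun s => hillE α (x s) (y s) (deriv x s) (deriv y s)) h2 ?_
  simp only [hillVx, hillVy, Real.rpow_add hr, Real.rpow_two]
  field_simp
  ring

lemma hill_dom {Tmax : ℝ≥0∞} {t s : ℝ} (ht : t ∈ hillDomain Tmax) (hs : s ∈ Icc 0 t) :
    s ∈ hillDomain Tmax :=
  ⟨hs.1, (ENNReal.ofReal_le_ofReal hs.2).trans_lt ht.2⟩

lemma hillE_const {α : ℝ} {x y : ℝ → ℝ} {Tmax : ℝ≥0∞} (hs : HillSolOn α x y Tmax)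
    {t : ℝ} (ht : t ∈ hillDomain Tmax) :
    hillE α (x t) (y t) (deriv x t) (deriv y t)
      = hillE α (x 0) (y 0) (deriv x 0) (deriv y 0) := by
  refine constant_of_has_deriv_right_zero
    (f := fun s => hillE α (x s) (y s) (deriv x s) (deriv y s)) (a := 0) (b := t) ?_ ?_ t
    ⟨ht.1, le_rfl⟩
  · exact fun s h => (hillE_deriv hs (hill_dom ht h)).continuousAt.continuousWithinAt
  · exact fun s h => (hillE_deriv hs (hill_dom ht ⟨h.1, h.2.le⟩)).hasDerivWithinAt

lemma hillW_cont {α : ℝ} {x y : ℝ → ℝ} {Tmax : ℝ≥0∞} (hs : HillSolOn α x y Tmax)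
    {t : ℝ} (ht : t ∈ hillDomain Tmax) :
    ContinuousOn (fun s => hillW α (x s) (y s)) (Icc 0 t) := by
  intro s h
  obtain ⟨h, hx, hy, -, -⟩ := hs s (hill_dom ht h)
  have h1 := (hillR_rpow_deriv (α := α) h hx hy).continuousAt
  have hp := Real.rpow_pos_of_pos (hillR_pos h) α
  exact (continuousAt_const.mul ((hx.continuousAt.pow 2).sub
    (continuousAt_const.div h1 hp.ne'))).continuousWithinAt

/-- the sets 𝒲₊ = {E < E*, W > 0} and 𝒲₋ = {E < E*, W ≤ 0} are invariant
under the flow of Hill's lunar equations. -/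
theorem hill_below_ground_state_invariance
    (α : ℝ) (hα : 0 < α) (Tmax : ℝ≥0∞) (hT : 0 < Tmax) (x y : ℝ → ℝ)
    (hsol : HillMaxSol α x y Tmax) :
    ((hillE α (x 0) (y 0) (deriv x 0) (deriv y 0) < hillEstar α ∧
        0 < hillW α (x 0) (y 0)) →
      ∀ t ∈ hillDomain Tmax,
        hillE α (x t) (y t) (deriv x t) (deriv y t) < hillEstar α ∧
          0 < hillW α (x t) (y t)) ∧
    ((hillE α (x 0) (y 0) (deriv x 0) (deriv y 0) < hillEstar α ∧
        hillW α (x 0) (y 0) ≤ 0) →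
      ∀ t ∈ hillDomain Tmax,
        hillE α (x t) (y t) (deriv x t) (deriv y t) < hillEstar α ∧
          hillW α (x t) (y t) ≤ 0) := by
  obtain ⟨hs, -⟩ := hsol
  have key : hillE α (x 0) (y 0) (deriv x 0) (deriv y 0) < hillEstar α →
      ∀ t ∈ hillDomain Tmax, hillW α (x t) (y t) ≠ 0 := by
    intro hE t ht h0
    have h1 := hillW_zero_energy hα (hs t ht).1 h0 (deriv x t) (deriv y t)
    rw [hillE_const hs ht] at h1
    linarith
  constructor
  · rintro ⟨hE, hW⟩ t ht
    refine ⟨by rw [hillE_const hs ht]; exact hE, ?_⟩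
    by_contra hc
    obtain ⟨s, h1, h2⟩ := intermediate_value_Icc' ht.1 (hillW_cont hs ht) ⟨not_lt.1 hc, hW.le⟩
    exact key hE s (hill_dom ht h1) h2
  · rintro ⟨hE, hW⟩ t ht
    refine ⟨by rw [hillE_const hs ht]; exact hE, ?_⟩
    by_contra hc
    obtain ⟨s, h1, h2⟩ := intermediate_value_Icc ht.1 (hillW_cont hs ht) ⟨hW, (not_le.1 hc).le⟩
    exact key hE s (hill_dom ht h1) h2
end

section
/- Fix a real parameter α > 0. Every solution of Hill's lunar equations whose initial phase point Γ(0) satisfies E(Γ(0)) < E* and W(Γ(0)) > 0 exists globally in forward time, i.e. its maximal time of existence is T_max = ∞; moreover r(t) = √(x(t)² + y(t)²) stays bounded away from 0. -/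
open Real Set Filter Topology ENNReal

def HillPt (α : ℝ) (x y : ℝ → ℝ) (t : ℝ) : Prop :=
    (x t, y t) ≠ (0, 0) ∧
    HasDerivAt x (deriv x t) t ∧ HasDerivAt y (deriv y t) t ∧
    HasDerivAt (deriv x) (2 * deriv y t - hillVx α (x t) (y t)) t ∧
    HasDerivAt (deriv y) (-(2 * deriv x t) - hillVy α (x t) (y t)) t

lemma HillPt.congr {α : ℝ} {x y x₂ y₂ : ℝ → ℝ} {t : ℝ} (h : HillPt α x y t)
    (hx : x₂ =ᶠ[𝓝 t] x) (hy : y₂ =ᶠ[𝓝 t] y) : HillPt α x₂ y₂ t := by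
  obtain ⟨h0, h1, h2, h3, h4⟩ := h
  have e1 := hx.eq_of_nhds
  have e2 := hy.eq_of_nhds
  have e3 := hx.deriv.eq_of_nhds
  have e4 := hy.deriv.eq_of_nhds
  refine ⟨by rwa [e1, e2], ?_, ?_, ?_, ?_⟩
  · rw [e3]; exact h1.congr_of_eventuallyEq hx
  · rw [e4]; exact h2.congr_of_eventuallyEq hy
  · rw [e4, e1, e2]; exact h3.congr_of_eventuallyEq hx.deriv
  · rw [e3, e1, e2]; exact h4.congr_of_eventuallyEq hy.deriv

noncomputable def hillF (α : ℝ) (p : ℝ × ℝ × ℝ × ℝ) : ℝ × ℝ × ℝ × ℝ :=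
  (p.2.2.1, p.2.2.2, 2 * p.2.2.2 - hillVx α p.1 p.2.1, -(2 * p.2.2.1) - hillVy α p.1 p.2.1)

lemma sq_pos_of_ne {a b : ℝ} (h : (a, b) ≠ (0, 0)) : 0 < a ^ 2 + b ^ 2 := by
  rcases eq_or_ne a 0 with rfl | ha
  · have : b ≠ 0 := by rintro rfl; exact h rfl
    positivity
  · positivity

lemma hillR_pos_s1 {a b : ℝ} (h : (a, b) ≠ (0, 0)) : 0 < hillR a b :=
  Real.sqrt_pos.2 (sq_pos_of_ne h)

lemma hillF_contDiffAt (α : ℝ) {p : ℝ × ℝ × ℝ × ℝ} (h : (p.1, p.2.1) ≠ (0, 0)) :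
    ContDiffAt ℝ 1 (hillF α) p := by
  have hs := sq_pos_of_ne h
  have hr := hillR_pos_s1 h
  have hR : ContDiffAt ℝ 1 (fun p : ℝ × ℝ × ℝ × ℝ => hillR p.1 p.2.1) p := by
    unfold hillR
    apply ContDiffAt.sqrt
    · fun_prop
    · exact hs.ne'
  have hRp : ContDiffAt ℝ 1 (fun p : ℝ × ℝ × ℝ × ℝ => hillR p.1 p.2.1 ^ (α + 2)) p :=
    hR.rpow_const_of_ne hr.ne'
  have hne : hillR p.1 p.2.1 ^ (α + 2) ≠ 0 := (Real.rpow_pos_of_pos hr _).ne'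
  unfold hillF hillVx hillVy
  refine ContDiffAt.prodMk (by fun_prop) (ContDiffAt.prodMk (by fun_prop) (ContDiffAt.prodMk ?_ ?_))
  · refine ContDiffAt.sub (by fun_prop) (ContDiffAt.add (by fun_prop) (ContDiffAt.div (by fun_prop) hRp hne))
  · refine ContDiffAt.sub (by fun_prop) (ContDiffAt.div (by fun_prop) hRp hne)

lemma HillPt.phase {α : ℝ} {x y : ℝ → ℝ} {t : ℝ} (h : HillPt α x y t) :
    HasDerivAt (fun s => (x s, y s, deriv x s, deriv y s))
      (hillF α (x t, y t, deriv x t, deriv y t)) t := by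
  obtain ⟨h0, h1, h2, h3, h4⟩ := h
  exact h1.prodMk (h2.prodMk (h3.prodMk h4))

lemma HillPt.of_phase {α : ℝ} {b : ℝ → ℝ × ℝ × ℝ × ℝ} {t : ℝ}
    (h : ∀ᶠ s in 𝓝 t, HasDerivAt b (hillF α (b s)) s) (h0 : ((b t).1, (b t).2.1) ≠ (0, 0)) :
    HillPt α (fun s => (b s).1) (fun s => (b s).2.1) t := by
  have k1 : ∀ᶠ s in 𝓝 t, HasDerivAt (fun s => (b s).1) (b s).2.2.1 s := by
    filter_upwards [h] with s hs
    exact hs.fst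
  have k2 : ∀ᶠ s in 𝓝 t, HasDerivAt (fun s => (b s).2.1) (b s).2.2.2 s := by
    filter_upwards [h] with s hs
    exact hs.snd.fst
  have d1 : deriv (fun s => (b s).1) =ᶠ[𝓝 t] fun s => (b s).2.2.1 := by
    filter_upwards [k1] with s hs using hs.deriv
  have d2 : deriv (fun s => (b s).2.1) =ᶠ[𝓝 t] fun s => (b s).2.2.2 := by
    filter_upwards [k2] with s hs using hs.deriv
  have e1 := d1.eq_of_nhds
  have e2 := d2.eq_of_nhds
  have ht := h.self_of_nhds
  refine ⟨h0, ?_, ?_, ?_, ?_⟩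
  · rw [e1]; exact k1.self_of_nhds
  · rw [e2]; exact k2.self_of_nhds
  · rw [e2]
    have k : HasDerivAt (fun s => (b s).2.2.1) (hillF α (b t)).2.2.1 t := ht.snd.snd.fst
    exact k.congr_of_eventuallyEq d1
  · rw [e1]
    have k : HasDerivAt (fun s => (b s).2.2.2) (hillF α (b t)).2.2.2 t := ht.snd.snd.snd
    exact k.congr_of_eventuallyEq d2

/-- local uniqueness -/
lemma hill_local_unique {α : ℝ} {f g : ℝ → ℝ × ℝ × ℝ × ℝ} {t : ℝ}
    (hf : ∀ᶠ s in 𝓝 t, HasDerivAt f (hillF α (f s)) s)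
    (hg : ∀ᶠ s in 𝓝 t, HasDerivAt g (hillF α (g s)) s)
    (h0 : ((f t).1, (f t).2.1) ≠ (0, 0)) (he : f t = g t) : f =ᶠ[𝓝 t] g := by
  obtain ⟨K, u, hu, hL⟩ := (hillF_contDiffAt α h0).exists_lipschitzOnWith
  have cf : ∀ᶠ s in 𝓝 t, f s ∈ u := hf.self_of_nhds.continuousAt hu
  have cg : ∀ᶠ s in 𝓝 t, g s ∈ u := hg.self_of_nhds.continuousAt (he ▸ hu)
  exact ODE_solution_unique_of_eventually (v := fun _ => hillF α) (s := fun _ => u) (K := K)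
    (Eventually.of_forall fun _ => hL) (hf.and cf) (hg.and cg) he

lemma hill_unique {α : ℝ} {f g : ℝ → ℝ × ℝ × ℝ × ℝ} {a b t : ℝ} (ht : t ∈ Ioo a b)
    (hf : ∀ s ∈ Ioo a b, HasDerivAt f (hillF α (f s)) s)
    (hg : ∀ s ∈ Ioo a b, HasDerivAt g (hillF α (g s)) s)
    (h0 : ∀ s ∈ Ioo a b, ((f s).1, (f s).2.1) ≠ (0, 0)) (he : f t = g t) :
    ∀ s ∈ Ioo a b, f s = g s := by
  have key : ∀ s ∈ Ioo a b, f s = g s → f =ᶠ[𝓝 s] g := fun s hs e =>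
    hill_local_unique
      (by filter_upwards [isOpen_Ioo.mem_nhds hs] with r hr using hf r hr)
      (by filter_upwards [isOpen_Ioo.mem_nhds hs] with r hr using hg r hr) (h0 s hs) e
  have hsub : Ioo a b ⊆ {s | f =ᶠ[𝓝 s] g} := by
    refine isPreconnected_Ioo.subset_of_closure_inter_subset ?_ ⟨t, ht, key t ht he⟩ ?_
    · exact isOpen_setOfPred_eventually_nhds
    · rintro s ⟨hs1, hs2⟩
      refine key s hs2 ?_
      have hfr : ∃ᶠ r in 𝓝 s, f r = g r :=
        (mem_closure_iff_frequently.1 hs1).mono fun r hr => hr.eq_of_nhds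
      by_contra hne
      have c : ∀ᶠ r in 𝓝 s, f r ≠ g r :=
        (((hf s hs2).continuousAt.sub (hg s hs2).continuousAt).eventually_ne
          (sub_ne_zero.2 hne)).mono fun r hr => sub_ne_zero.1 hr
      exact hfr c
  exact fun s hs => (hsub hs).eq_of_nhds

lemma HillPt.hasDerivAt_R {α : ℝ} {x y : ℝ → ℝ} {t : ℝ} (h : HillPt α x y t) :
    HasDerivAt (fun s => hillR (x s) (y s))
      ((x t * deriv x t + y t * deriv y t) / hillR (x t) (y t)) t := by
  obtain ⟨h0, h1, h2, -, -⟩ := h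
  have hs := sq_pos_of_ne h0
  have hr := hillR_pos_s1 h0
  have := ((h1.pow 2).add (h2.pow 2)).sqrt hs.ne'
  refine this.congr_deriv ?_
  change _ / (2 * hillR (x t) (y t)) = _
  field_simp
  simp
  ring

lemma HillPt.energy {α : ℝ} {x y : ℝ → ℝ} {t : ℝ} (h : HillPt α x y t) :
    HasDerivAt (fun s => hillE α (x s) (y s) (deriv x s) (deriv y s)) 0 t := by
  have hR := h.hasDerivAt_R
  obtain ⟨h0, h1, h2, h3, h4⟩ := h
  have hr := hillR_pos_s1 h0
  have hp := Real.rpow_pos_of_pos hr α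
  have hA := (hasDerivAt_const t (α + 2)).div (hR.rpow_const (p := α) (Or.inl hr.ne')) hp.ne'
  have := (((h3.pow 2).add (h4.pow 2)).const_mul (1 / 2)).add
    (((h1.pow 2).const_mul (-((α + 2) / 2))).sub hA)
  refine this.congr_deriv ?_
  unfold hillVx hillVy
  rw [Real.rpow_add hr, Real.rpow_sub hr, Real.rpow_one, Real.rpow_two]
  generalize hillR (x t) (y t) ^ α = Q at *
  generalize hillR (x t) (y t) = r at *
  field_simp
  simp
  ring

lemma hill_W_zero {α a b u v : ℝ} (hα : 0 < α) (h0 : (a, b) ≠ (0, 0)) (hW : hillW α a b = 0) :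
    hillEstar α ≤ hillE α a b u v := by
  have hr := hillR_pos_s1 h0
  have hp := Real.rpow_pos_of_pos hr α
  have hr2 : hillR a b ^ 2 = a ^ 2 + b ^ 2 := Real.sq_sqrt (by positivity)
  have hx : a ^ 2 = α / hillR a b ^ α := by
    unfold hillW at hW
    have := (mul_eq_zero.1 hW).resolve_left (by positivity)
    linarith
  have h1 : α ≤ hillR a b ^ (α + 2) := by
    rw [Real.rpow_add hr, Real.rpow_two, hr2]
    have : a ^ 2 * hillR a b ^ α = α := by rw [hx]; field_simp
    nlinarith [sq_nonneg b, mul_nonneg (sq_nonneg b) hp.le]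
  have h2 : α ^ (α / (α + 2)) ≤ hillR a b ^ α := by
    calc α ^ (α / (α + 2)) ≤ (hillR a b ^ (α + 2)) ^ (α / (α + 2)) :=
          Real.rpow_le_rpow hα.le h1 (by positivity)
      _ = hillR a b ^ α := by
          rw [← Real.rpow_mul hr.le]; congr 1; field_simp
  have h3 : 1 / hillR a b ^ α ≤ α ^ (-(α / (α + 2))) := by
    rw [Real.rpow_neg hα.le, ← one_div]
    exact one_div_le_one_div_of_le (Real.rpow_pos_of_pos hα _) h2
  unfold hillE hillV hillEstar
  rw [hx]
  have h4 : -((α + 2) / 2) * (α / hillR a b ^ α) - (α + 2) / hillR a b ^ α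
     = -(1/2) * (α + 2) ^ 2 * (1 / hillR a b ^ α) := by field_simp; ring
  rw [h4]
  nlinarith [sq_nonneg u, sq_nonneg v, mul_le_mul_of_nonneg_left h3 (sq_nonneg (α + 2))]

lemma hill_W_pos {α a b : ℝ} (hα : 0 < α) (h0 : (a, b) ≠ (0, 0)) (hW : 0 < hillW α a b) :
    α ≤ hillR a b ^ (α + 2) := by
  have hr := hillR_pos_s1 h0
  have hp := Real.rpow_pos_of_pos hr α
  have hr2 : hillR a b ^ 2 = a ^ 2 + b ^ 2 := Real.sq_sqrt (by positivity)
  unfold hillW at hW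
  have hx := (pos_iff_pos_of_mul_pos hW).1 (by positivity)
  have hx : α / hillR a b ^ α < a ^ 2 := by linarith
  rw [div_lt_iff₀ hp] at hx
  rw [Real.rpow_add hr, Real.rpow_two, hr2]
  nlinarith [sq_nonneg b, mul_nonneg (sq_nonneg b) hp.le]

lemma hill_W_stays {α : ℝ} (hα : 0 < α) {x y : ℝ → ℝ} {t : ℝ} (ht : 0 ≤ t)
    (h : ∀ s ∈ Icc 0 t, HillPt α x y s)
    (hE : hillE α (x 0) (y 0) (deriv x 0) (deriv y 0) < hillEstar α)
    (hW : 0 < hillW α (x 0) (y 0)) : 0 < hillW α (x t) (y t) := by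
  by_contra hneg
  push Not at hneg
  have hc : ContinuousOn (fun s => hillW α (x s) (y s)) (Icc 0 t) := by
    intro s hs
    have hp := h s hs
    have hr := hillR_pos_s1 hp.1
    have c1 : ContinuousAt x s := hp.2.1.continuousAt
    have c2 := hp.hasDerivAt_R.continuousAt.rpow_const (p := α) (Or.inl hr.ne')
    unfold hillW
    exact (continuousAt_const.mul ((c1.pow 2).sub (continuousAt_const.div c2
      (Real.rpow_pos_of_pos hr α).ne'))).continuousWithinAt
  obtain ⟨s, hs, hs0⟩ := intermediate_value_Icc' ht hc ⟨hneg, hW.le⟩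
  have hEs := constant_of_has_deriv_right_zero
    (f := fun s => hillE α (x s) (y s) (deriv x s) (deriv y s)) (a := 0) (b := t)
    (fun r hr => (h r hr).energy.continuousAt.continuousWithinAt)
    (fun r hr => (h r (Ico_subset_Icc_self hr)).energy.hasDerivWithinAt) s hs
  have := hill_W_zero (u := deriv x s) (v := deriv y s) hα (h s hs).1 hs0
  linarith

lemma hill_growth {α : ℝ} (hα : 0 < α) {x y : ℝ → ℝ} {t : ℝ} (ht : 0 ≤ t)
    (h : ∀ s ∈ Icc 0 t, HillPt α x y s)
    (hr : ∀ s ∈ Icc 0 t, α ≤ hillR (x s) (y s) ^ (α + 2)) :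
    x t ^ 2 + y t ^ 2 + deriv x t ^ 2 + deriv y t ^ 2 ≤
     (x 0 ^ 2 + y 0 ^ 2 + deriv x 0 ^ 2 + deriv y 0 ^ 2) * exp ((α + 3) * t) := by
  set N : ℝ → ℝ := fun s => x s ^ 2 + y s ^ 2 + deriv x s ^ 2 + deriv y s ^ 2 with hN
  have hd : ∀ s ∈ Icc 0 t, ∃ d, d ≤ (α + 3) * N s ∧ HasDerivAt N d s := by
    intro s hs
    obtain ⟨-, h1, h2, h3, h4⟩ := h s hs
    have hd : HasDerivAt N _ s := (((h1.pow 2).add (h2.pow 2)).add (h3.pow 2)).add (h4.pow 2)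
    refine ⟨_, ?_, hd⟩
    have hq := hr s hs
    have hq0 : 0 < hillR (x s) (y s) ^ (α + 2) := by linarith
    set k := α / hillR (x s) (y s) ^ (α + 2) with hk
    have k0 : 0 ≤ k := by positivity
    have k1 : k ≤ 1 := (div_le_one hq0).2 hq
    have e1 : hillVx α (x s) (y s) = -(α + 2) * (1 - k) * x s := by
      unfold hillVx; rw [hk]; ring
    have e2 : hillVy α (x s) (y s) = (α + 2) * k * y s := by
      unfold hillVy; rw [hk]; ring
    rw [e1, e2]
    simp only [hN]
    generalize x s = X
    generalize y s = Y
    generalize deriv x s = U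
    generalize deriv y s = V
    have a1 : (1 - k) * (2 * X * U) ≤ X ^ 2 + U ^ 2 := by
      nlinarith [sq_nonneg (X - U), sq_nonneg (X + U), mul_nonneg (sub_nonneg.2 k1) (sq_nonneg (X - U)), mul_nonneg k0 (sq_nonneg X), mul_nonneg k0 (sq_nonneg U)]
    have a2 : -(k * (2 * Y * V)) ≤ Y ^ 2 + V ^ 2 := by
      nlinarith [mul_nonneg k0 (sq_nonneg (Y + V)), mul_nonneg (sub_nonneg.2 k1) (sq_nonneg Y), mul_nonneg (sub_nonneg.2 k1) (sq_nonneg V)]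
    have a3 := mul_le_mul_of_nonneg_left a1 (by positivity : 0 ≤ α + 2)
    have a4 := mul_le_mul_of_nonneg_left a2 (by positivity : 0 ≤ α + 2)
    have a5 := sq_nonneg (X - U)
    have a6 := sq_nonneg (Y - V)
    norm_num
    nlinarith
  choose! d hd1 hd2 using hd
  have hd' : ∀ s ∈ Icc 0 t, HasDerivAt (fun s => N s * exp (-((α + 3) * s)))
      (d s * exp (-((α + 3) * s)) + N s * (exp (-((α + 3) * s)) * (-((α + 3) * 1)))) s := by
    intro s hs
    exact (hd2 s hs).mul (((hasDerivAt_id s).const_mul (α + 3)).neg.exp)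
  have hanti : AntitoneOn (fun s => N s * exp (-((α + 3) * s))) (Icc 0 t) := by
    apply antitoneOn_of_deriv_nonpos (convex_Icc 0 t)
    · exact fun s hs => (hd' s hs).continuousAt.continuousWithinAt
    · exact fun s hs => (hd' s (interior_subset hs)).differentiableAt.differentiableWithinAt
    · intro s hs
      have hs := interior_subset hs
      rw [(hd' s hs).deriv]
      have := mul_le_mul_of_nonneg_right (hd1 s hs) (exp_pos (-((α + 3) * s))).le
      linarith
  have := hanti (left_mem_Icc.2 ht) (right_mem_Icc.2 ht) ht
  simp only [mul_zero, neg_zero, exp_zero, mul_one] at this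
  rw [exp_neg, ← div_eq_mul_inv, div_le_iff₀ (exp_pos _)] at this
  exact this

lemma hillR_continuous : Continuous fun p : ℝ × ℝ × ℝ × ℝ => hillR p.1 p.2.1 := by
  unfold hillR; fun_prop

lemma ne_of_hillR_pos {a b : ℝ} (h : 0 < hillR a b) : (a, b) ≠ (0, 0) := by
  intro e
  simp only [Prod.mk.injEq] at e
  obtain ⟨rfl, rfl⟩ := e
  simp [hillR] at h

lemma hill_extend {α T c C : ℝ} (hT : 0 < T) (hc : 0 < c) {x y : ℝ → ℝ}
    (hP : ∀ t ∈ Ico 0 T, HillPt α x y t)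
    (hr : ∀ t ∈ Ico 0 T, c ≤ hillR (x t) (y t))
    (hC : ∀ t ∈ Ico 0 T, x t ^ 2 + y t ^ 2 + deriv x t ^ 2 + deriv y t ^ 2 ≤ C) :
    ∃ T' > T, ∃ x₂ y₂ : ℝ → ℝ, (∀ t ∈ Ico 0 T', HillPt α x₂ y₂ t) ∧
      ∀ t ∈ Ico 0 T, x₂ t = x t ∧ y₂ t = y t := by
  set G : ℝ → ℝ × ℝ × ℝ × ℝ := fun s => (x s, y s, deriv x s, deriv y s) with hG
  have hGd : ∀ t ∈ Ico 0 T, HasDerivAt G (hillF α (G t)) t := fun t ht => (hP t ht).phase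
  have hGb : ∀ t ∈ Ico 0 T, G t ∈ Metric.closedBall (0 : ℝ × ℝ × ℝ × ℝ) (C + 1) := by
    intro t ht
    have := hC t ht
    have key : ∀ z : ℝ, z ^ 2 ≤ C → |z| ≤ C + 1 := by
      intro z hz
      rw [abs_le]
      constructor <;> nlinarith [sq_nonneg (z - 1), sq_nonneg (z + 1)]
    have p1 := sq_nonneg (x t)
    have p2 := sq_nonneg (y t)
    have p3 := sq_nonneg (deriv x t)
    have p4 := sq_nonneg (deriv y t)
    rw [mem_closedBall_zero_iff]
    simp only [hG, Prod.norm_def, Real.norm_eq_abs, sup_le_iff]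
    exact ⟨key _ (by linarith), key _ (by linarith), key _ (by linarith), key _ (by linarith)⟩
  -- the sequence of times
  obtain ⟨u, -, huI, hu⟩ := exists_seq_strictMono_tendsto' hT
  obtain ⟨p, -, φ, hφ, hlim⟩ := (isCompact_closedBall (0 : ℝ × ℝ × ℝ × ℝ) (C + 1)).tendsto_subseq
    (x := fun n => G (u n)) (fun n => hGb _ ⟨(huI n).1.le, (huI n).2⟩)
  have hpc : c ≤ hillR p.1 p.2.1 :=
    ge_of_tendsto ((hillR_continuous.tendsto p).comp hlim)
      (Eventually.of_forall fun n => hr _ ⟨(huI _).1.le, (huI _).2⟩)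
  have hp0 := ne_of_hillR_pos (hc.trans_le hpc)
  obtain ⟨ρ, hρ, ε, hε, H⟩ :=
    (hillF_contDiffAt α hp0).exists_forall_mem_closedBall_exists_eq_forall_mem_Ioo_hasDerivAt 0
  have ev1 : ∀ᶠ n in atTop, G (u (φ n)) ∈ Metric.closedBall p ρ :=
    hlim (Metric.closedBall_mem_nhds p hρ)
  have ev2 : ∀ᶠ n in atTop, T - ε < u (φ n) :=
    (hu.comp hφ.tendsto_atTop).eventually (lt_mem_nhds (by linarith))
  obtain ⟨n, hn1, hn2⟩ := (ev1.and ev2).exists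
  obtain ⟨hτ0, hτT⟩ := huI (φ n)
  generalize u (φ n) = τ at *
  obtain ⟨b, hb0, hb⟩ := H _ hn1
  set B : ℝ → ℝ × ℝ × ℝ × ℝ := fun s => b (s - τ) with hB
  have hBd : ∀ s ∈ Ioo (τ - ε) (τ + ε), HasDerivAt B (hillF α (B s)) s := by
    intro s hs
    exact HasDerivAt.comp_sub_const s τ (hb (s - τ) ⟨by linarith [hs.1], by linarith [hs.2]⟩)
  have huniq : ∀ s ∈ Ioo (max 0 (τ - ε)) T, G s = B s := by
    refine hill_unique (α := α) (t := τ) ⟨max_lt hτ0 (by linarith), hτT⟩ ?_ ?_ ?_ ?_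
    · exact fun s hs => hGd s ⟨((le_max_left _ _).trans_lt hs.1).le, hs.2⟩
    · exact fun s hs => hBd s ⟨(le_max_right _ _).trans_lt hs.1, by linarith [hs.2]⟩
    · exact fun s hs => (hP s ⟨((le_max_left _ _).trans_lt hs.1).le, hs.2⟩).1
    · simp [hB, hb0]
  have huniq' : ∀ s ∈ Ioo τ T, G s = B s :=
    fun s hs => huniq s ⟨max_lt (hτ0.trans hs.1) (by linarith [hs.1]), hs.2⟩
  have hBR : ContinuousAt (fun s => hillR (B s).1 (B s).2.1) T :=
    hillR_continuous.continuousAt.comp (hBd T ⟨by linarith, by linarith⟩).continuousAt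
  have hBT : c ≤ hillR (B T).1 (B T).2.1 := by
    refine ge_of_tendsto (hBR.tendsto.mono_left (nhdsWithin_le_nhds (s := Iio T))) ?_
    filter_upwards [Ioo_mem_nhdsLT hτT] with s hs
    rw [← huniq' s hs]
    exact hr s ⟨(hτ0.trans hs.1).le, hs.2⟩
  obtain ⟨δ, hδ, hδ'⟩ := Metric.eventually_nhds_iff.1
    (hBR.eventually (lt_mem_nhds (hc.trans_le hBT)))
  refine ⟨min (T + δ) (τ + ε), lt_min (by linarith) (by linarith),
    fun s => if s < T then x s else (B s).1, fun s => if s < T then y s else (B s).2.1, ?_, ?_⟩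
  · rintro t ⟨ht0, ht1⟩
    have ht2 := ht1.trans_le (min_le_left _ _)
    have ht3 := ht1.trans_le (min_le_right _ _)
    by_cases htT : t < T
    · refine (hP t ⟨ht0, htT⟩).congr ?_ ?_ <;>
      · filter_upwards [gt_mem_nhds htT] with s hs
        simp [hs]
    · push Not at htT
      have hτt : τ < t := by linarith
      have hpt : HillPt α (fun s => (B s).1) (fun s => (B s).2.1) t := by
        apply HillPt.of_phase
        · filter_upwards [isOpen_Ioo.mem_nhds (show t ∈ Ioo (τ - ε) (τ + ε) from
            ⟨by linarith, ht3⟩)] with s hs using hBd s hs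
        · apply ne_of_hillR_pos
          apply hδ'
          rw [Real.dist_eq, abs_lt]
          constructor <;> linarith
      refine hpt.congr ?_ ?_
      · filter_upwards [lt_mem_nhds hτt] with s hs
        split_ifs with h
        · rw [← huniq' s ⟨hs, h⟩]
        · rfl
      · filter_upwards [lt_mem_nhds hτt] with s hs
        split_ifs with h
        · rw [← huniq' s ⟨hs, h⟩]
        · rfl
  · intro t ht
    simp [ht.2]

/-- solutions starting in 𝒲₊ = {E < E*, W > 0} exist globally in forward
time, and r(t) stays bounded away from 0. -/
theorem hill_below_ground_state_global_existence
    (α : ℝ) (hα : 0 < α) (Tmax : ℝ≥0∞) (hT : 0 < Tmax) (x y : ℝ → ℝ)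
    (hsol : HillMaxSol α x y Tmax)
    (hE : hillE α (x 0) (y 0) (deriv x 0) (deriv y 0) < hillEstar α)
    (hW : 0 < hillW α (x 0) (y 0)) :
    Tmax = ⊤ ∧ ∃ c > 0, ∀ t ∈ hillDomain Tmax, c ≤ hillR (x t) (y t) := by
  obtain ⟨hS, hM⟩ := hsol
  have hsub : ∀ t ∈ hillDomain Tmax, ∀ s ∈ Icc 0 t, s ∈ hillDomain Tmax := fun t ht s hs =>
    ⟨hs.1, (ENNReal.ofReal_le_ofReal hs.2).trans_lt ht.2⟩
  have hP : ∀ t ∈ hillDomain Tmax, HillPt α x y t := hS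
  have hRp : ∀ t ∈ hillDomain Tmax, α ≤ hillR (x t) (y t) ^ (α + 2) := fun t ht =>
    hill_W_pos hα (hP t ht).1
      (hill_W_stays hα ht.1 (fun s hs => hP s (hsub t ht s hs)) hE hW)
  have hc : 0 < α ^ (1 / (α + 2)) := Real.rpow_pos_of_pos hα _
  have hR : ∀ t ∈ hillDomain Tmax, α ^ (1 / (α + 2)) ≤ hillR (x t) (y t) := by
    intro t ht
    have hr := hillR_pos_s1 (hP t ht).1
    calc α ^ (1 / (α + 2)) ≤ (hillR (x t) (y t) ^ (α + 2)) ^ (1 / (α + 2)) :=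
          Real.rpow_le_rpow hα.le (hRp t ht) (by positivity)
      _ = hillR (x t) (y t) := by
          rw [← Real.rpow_mul hr.le, mul_one_div_cancel (by positivity), Real.rpow_one]
  refine ⟨?_, _, hc, hR⟩
  by_contra htop
  have hT0 : 0 < Tmax.toReal := ENNReal.toReal_pos hT.ne' htop
  have hdom : ∀ (T' t : ℝ), t ∈ hillDomain (ENNReal.ofReal T') → t ∈ Ico 0 T' := by
    intro T' t ht
    exact ⟨ht.1, (ENNReal.ofReal_lt_ofReal_iff'.1 ht.2).1⟩
  have hdom1 : ∀ t ∈ Ico 0 Tmax.toReal, t ∈ hillDomain Tmax := fun t ht =>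
    ⟨ht.1, (ENNReal.ofReal_lt_iff_lt_toReal ht.1 htop).2 ht.2⟩
  obtain ⟨T', hT', x₂, y₂, h1, h2⟩ := hill_extend (α := α) hT0 hc
    (fun t ht => hP t (hdom1 t ht)) (fun t ht => hR t (hdom1 t ht))
    (C := (x 0 ^ 2 + y 0 ^ 2 + deriv x 0 ^ 2 + deriv y 0 ^ 2) * exp ((α + 3) * Tmax.toReal))
    (fun t ht => (hill_growth hα ht.1 (fun s hs => hP s (hsub t (hdom1 t ht) s hs))
      (fun s hs => hRp s (hsub t (hdom1 t ht) s hs))).trans (by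
        have := ht.2.le
        gcongr))
  refine hM (ENNReal.ofReal T') ((ENNReal.lt_ofReal_iff_toReal_lt htop).2 hT') ⟨x₂, y₂, ?_, ?_⟩
  · intro t ht
    exact h1 t (hdom T' t ht)
  · intro t ht
    exact h2 t ⟨ht.1, (ENNReal.ofReal_lt_iff_lt_toReal ht.1 htop).1 ht.2⟩
end

section
/- Fix a real parameter α > 0. The infimum of the energy E(x, y, ẋ, ẏ) over all phase points (x, y, ẋ, ẏ) ∈ ℝ⁴ with (x,y) ≠ (0,0) satisfying the constraint W = 0 is finite and equals E* = −½(α+2)² α^{−α/(α+2)}; moreover this infimum is attained exactly at the two points ±Q = (±α^{1/(α+2)}, 0, 0, 0). -/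
open Real Set Filter Topology ENNReal

theorem hill_aux (α : ℝ) (hα : 0 < α) (x y : ℝ) (hxy : (x, y) ≠ (0, 0))
    (hW : hillW α x y = 0) :
    x ^ 2 ≤ (α ^ ((1 : ℝ) / (α + 2))) ^ 2 ∧
    (x ^ 2 = (α ^ ((1 : ℝ) / (α + 2))) ^ 2 → y = 0) ∧
    hillV α x y = -((α + 2) ^ 2 / (2 * α)) * x ^ 2 := by
  set q := α ^ ((1 : ℝ) / (α + 2)) with hq
  have hq0 : 0 < q := Real.rpow_pos_of_pos hα _
  have hqa : q ^ (α + 2) = α := by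
    rw [hq, ← Real.rpow_mul hα.le, one_div_mul_cancel (by positivity), Real.rpow_one]
  have hs : 0 < x ^ 2 + y ^ 2 := by
    by_contra h
    apply hxy
    have hx : x ^ 2 = 0 := by nlinarith [sq_nonneg x, sq_nonneg y]
    have hy : y ^ 2 = 0 := by nlinarith [sq_nonneg x, sq_nonneg y]
    simp at hx hy
    simp [hx, hy]
  have hr0 : 0 < hillR x y := Real.sqrt_pos.2 hs
  have hr2 : hillR x y ^ 2 = x ^ 2 + y ^ 2 := Real.sq_sqrt hs.le
  have hra : 0 < hillR x y ^ α := Real.rpow_pos_of_pos hr0 _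
  have hqal : 0 < q ^ α := Real.rpow_pos_of_pos hq0 _
  have hx : x ^ 2 = α / hillR x y ^ α := by
    unfold hillW at hW
    rcases mul_eq_zero.1 hW with h | h <;> linarith
  have hx' : x ^ 2 * hillR x y ^ α = α := by
    rw [hx]; field_simp
  have e1 : hillR x y ^ (α + 2) = hillR x y ^ α * hillR x y ^ 2 := by
    rw [Real.rpow_add hr0]; norm_num
  have e2 : q ^ α * q ^ 2 = α := by
    have h := hqa
    rwa [Real.rpow_add hq0, Real.rpow_two] at h
  have hqr : q ≤ hillR x y := by
    rw [← Real.rpow_le_rpow_iff hq0.le hr0.le (show 0 < α + 2 by linarith), hqa, e1, hr2]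
    nlinarith [mul_nonneg hra.le (sq_nonneg y)]
  have hqr' : q ^ α ≤ hillR x y ^ α := Real.rpow_le_rpow hq0.le hqr hα.le
  refine ⟨?_, ?_, ?_⟩
  · by_contra h
    push Not at h
    nlinarith [mul_le_mul_of_nonneg_left hqr' (sq_nonneg x), mul_lt_mul_of_pos_right h hqal]
  · intro h
    have h3 : hillR x y ^ α = q ^ α := by
      have : q ^ 2 * hillR x y ^ α = q ^ 2 * q ^ α := by rw [← h, hx', h]; linarith
      exact mul_left_cancel₀ (by positivity) this
    have h4 : hillR x y = q :=
      (Real.rpow_left_inj hr0.le hq0.le hα.ne').1 h3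
    rw [h4] at hr2
    have : y ^ 2 = 0 := by linarith
    simpa using this
  · have : (α + 2) / hillR x y ^ α = (α + 2) / α * x ^ 2 := by
      rw [hx]; field_simp
    unfold hillV
    rw [this]; field_simp; ring

theorem hill_star (α : ℝ) (hα : 0 < α) :
    hillEstar α = -((α + 2) ^ 2 / (2 * α)) * (α ^ ((1 : ℝ) / (α + 2))) ^ 2 := by
  have h : α ^ (-(α / (α + 2))) = (α ^ ((1 : ℝ) / (α + 2))) ^ 2 / α := by
    have : -(α / (α + 2)) = (1 / (α + 2)) * (2 : ℕ) - 1 := by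
      push_cast; field_simp; ring
    rw [this, Real.rpow_sub hα, Real.rpow_one, Real.rpow_mul hα.le, Real.rpow_natCast]
  unfold hillEstar
  rw [h]; field_simp

/-- the infimum of E over the constraint set {W = 0} is finite, equals
E* = −½(α+2)²α^{−α/(α+2)}, and is attained exactly at ±Q = (±α^{1/(α+2)}, 0, 0, 0). -/
theorem hill_ground_state_characterization (α : ℝ) (hα : 0 < α) :
    IsLeast {e : ℝ | ∃ x y vx vy : ℝ, (x, y) ≠ (0, 0) ∧ hillW α x y = 0 ∧
        e = hillE α x y vx vy} (hillEstar α) ∧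
    ∀ x y vx vy : ℝ, (x, y) ≠ (0, 0) → hillW α x y = 0 →
      hillE α x y vx vy = hillEstar α →
        (x, y, vx, vy) = (α ^ ((1 : ℝ) / (α + 2)), 0, 0, 0) ∨
          (x, y, vx, vy) = (-(α ^ ((1 : ℝ) / (α + 2))), 0, 0, 0) := by
  have hc : 0 < (α + 2) ^ 2 / (2 * α) := by positivity
  have hst := hill_star α hα
  have hq0 : 0 < α ^ ((1 : ℝ) / (α + 2)) := Real.rpow_pos_of_pos hα _
  refine ⟨⟨?_, ?_⟩, ?_⟩
  · have hne : (α ^ ((1 : ℝ) / (α + 2)), (0 : ℝ)) ≠ (0, 0) := by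
      intro h
      exact hq0.ne' (Prod.mk.inj h).1
    have hW : hillW α (α ^ ((1 : ℝ) / (α + 2))) 0 = 0 := by
      have hR : hillR (α ^ ((1 : ℝ) / (α + 2))) 0 = α ^ ((1 : ℝ) / (α + 2)) := by
        unfold hillR
        rw [show (0 : ℝ) ^ 2 = 0 by norm_num, add_zero, Real.sqrt_sq hq0.le]
      have hqa : (α ^ ((1 : ℝ) / (α + 2))) ^ (α + 2) = α := by
        rw [← Real.rpow_mul hα.le, one_div_mul_cancel (by positivity), Real.rpow_one]
      unfold hillW
      rw [hR]
      generalize α ^ ((1 : ℝ) / (α + 2)) = q at *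
      have hqal : 0 < q ^ α := Real.rpow_pos_of_pos hq0 _
      rw [Real.rpow_add hq0, Real.rpow_two] at hqa
      have : α / q ^ α = q ^ 2 := by
        rw [div_eq_iff hqal.ne']; linarith
      rw [this]; ring
    refine ⟨_, 0, 0, 0, hne, hW, ?_⟩
    rw [hillE, (hill_aux α hα _ _ hne hW).2.2, hst]; ring
  · rintro e ⟨x, y, vx, vy, hxy, hW, rfl⟩
    obtain ⟨h1, -, h3⟩ := hill_aux α hα x y hxy hW
    rw [hillE, h3, hst]
    nlinarith [mul_le_mul_of_nonneg_left h1 hc.le, sq_nonneg vx, sq_nonneg vy]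
  · intro x y vx vy hxy hW hE
    obtain ⟨h1, h2, h3⟩ := hill_aux α hα x y hxy hW
    rw [hillE, h3, hst] at hE
    have h4 := mul_le_mul_of_nonneg_left h1 hc.le
    have hvx : vx ^ 2 = 0 := by nlinarith [sq_nonneg vx, sq_nonneg vy]
    have hvy : vy ^ 2 = 0 := by nlinarith [sq_nonneg vx, sq_nonneg vy]
    have h5 : x ^ 2 = (α ^ ((1 : ℝ) / (α + 2))) ^ 2 := by
      apply mul_left_cancel₀ hc.ne'
      rw [hvx, hvy] at hE; linarith
    have hy := h2 h5
    have hvx' : vx = 0 := by simpa using hvx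
    have hvy' : vy = 0 := by simpa using hvy
    subst hy hvx' hvy'
    rcases sq_eq_sq_iff_eq_or_eq_neg.1 h5 with h | h
    · left; rw [h]
    · right; rw [h]
end

section
/- Fix a real parameter α ≥ 2. Then inf{E(Γ) : Γ = (x,y,ẋ,ẏ) ∈ ℝ⁴, (x,y) ≠ (0,0), K(Γ) ≥ 0 and W(Γ) ≤ 0} = inf{E(Γ) : K(Γ) = 0 and W(Γ) = 0} = E*, where E* = −½(α+2)² α^{−α/(α+2)}. -/
open Real Set Filter Topology ENNReal

theorem hill_alg (α τ δ : ℝ) (hα : 2 ≤ α) (hτ : 0 ≤ τ) (hδ : 0 ≤ δ) (hδ1 : δ ≤ 1)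
    (h : 2 * τ - α * δ ≤ α * δ * τ) :
    4 * α * (1 - δ) * (2 * τ - α * δ) ≤ (α + 2) * ((α - 2) * τ + 2 * α * δ) ^ 2 := by
  have h1 : 4 * α * (1 - δ) * (2 * τ - α * δ) ≤ 4 * α * (1 - δ) * (α * δ * τ) := by
    apply mul_le_mul_of_nonneg_left h
    have : 0 ≤ 1 - δ := by linarith
    positivity
  have h2 : α * τ * (1 - δ) ≤ α * δ + (α - 2) * τ := by linarith
  have h3 : 4 * α * δ * (α * τ * (1 - δ)) ≤ 4 * α * δ * (α * δ + (α - 2) * τ) := by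
    apply mul_le_mul_of_nonneg_left h2
    positivity
  have ha : 0 ≤ (α - 2) * τ := mul_nonneg (by linarith) hτ
  have hb : 0 ≤ α * δ := by positivity
  set A := (α - 2) * τ
  set D := α * δ
  have h4 : 4 * D * (D + A) ≤ (α + 2) * (A + 2 * D) ^ 2 := by
    nlinarith [mul_nonneg ha hb, sq_nonneg A, sq_nonneg D,
      mul_nonneg (by linarith : (0:ℝ) ≤ α - 2) (sq_nonneg (A + 2 * D))]
  have e : 2 * α * δ = 2 * D := by simp only [D]; ring
  rw [e]
  calc _ ≤ _ := h1
    _ = 4 * α * δ * (α * τ * (1 - δ)) := by ring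
    _ ≤ _ := h3
    _ = 4 * D * (D + A) := by simp only [D]; ring
    _ ≤ _ := h4

theorem hill_core (α r c n w τ δ : ℝ) (hα : 2 ≤ α) (hr : 0 < r) (hc : 0 < c) (hn : 0 ≤ n)
    (hw0 : 0 ≤ w) (hr2 : r ^ 2 = α * c * (1 - δ))
    (hτδ : 0 ≤ τ → 0 ≤ δ) (h : 2 * τ - α * δ ≤ α * δ * τ)
    (hw : (α + 2) * (α * c * (1 + τ) - r ^ 2) ≤ w) (hn2 : w ≤ n ^ 2 + 2 * r * n) :
    (α + 2) ^ 2 * (c * τ) ≤ n ^ 2 + w := by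
  rcases lt_or_ge τ 0 with ht | ht
  · have : c * τ < 0 := mul_neg_of_pos_of_neg hc ht
    nlinarith [sq_nonneg n, sq_nonneg (α + 2)]
  have hδ := hτδ ht
  have hδ1 : δ ≤ 1 := by
    by_contra hh
    have : α * c * (1 - δ) < 0 := mul_neg_of_pos_of_neg (by positivity) (by linarith)
    nlinarith [sq_nonneg r]
  have key := hill_alg α τ δ hα ht hδ hδ1 h
  by_contra! hlt
  set C := (α + 2) * c * ((α - 2) * τ + 2 * α * δ) with hC
  have hC0 : 0 ≤ C := by
    have : 0 ≤ α - 2 := by linarith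
    positivity
  set B := (α + 2) * c * (2 * τ - α * δ) with hB
  have hnB : n ^ 2 < B := by rw [hB]; rw [hr2] at hw; nlinarith
  have hCn : C < 2 * r * n := by
    have : C + B = (α + 2) * (α * c * (1 + τ) - r ^ 2) := by rw [hC, hB, hr2]; ring
    linarith
  have h1 : C ^ 2 < (2 * r * n) ^ 2 := by gcongr
  have h2 : 4 * r ^ 2 * B ≤ C ^ 2 := by
    have := mul_le_mul_of_nonneg_left key (by positivity : 0 ≤ (α + 2) * c ^ 2)
    rw [hr2, hB, hC]
    linarith
  have h3 : 4 * r ^ 2 * n ^ 2 < 4 * r ^ 2 * B := by gcongr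
  linarith [mul_pow (2 * r) n 2, mul_pow 2 r 2]

theorem hill_r0 (α : ℝ) (hα : 2 ≤ α) :
    (α ^ (1 / (α + 2))) ^ α = (α ^ (-(α / (α + 2))))⁻¹ ∧
    (α ^ (1 / (α + 2))) ^ (2:ℕ) = α * α ^ (-(α / (α + 2))) := by
  have h0 : 0 < α := by linarith
  constructor
  · rw [← Real.rpow_mul h0.le, Real.rpow_neg h0.le, inv_inv]
    congr 1; field_simp
  · rw [← Real.rpow_natCast, ← Real.rpow_mul h0.le]
    have e : α * α ^ (-(α / (α + 2))) = α ^ (1 + -(α / (α + 2))) := by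
      rw [Real.rpow_add h0, Real.rpow_one]
    rw [e]
    congr 1; field_simp; push_cast; ring

theorem hill_lower (α x y vx vy : ℝ) (hα : 2 ≤ α) (hxy : (x, y) ≠ (0, 0))
    (hK : 0 ≤ hillK α x y vx vy) (hW : hillW α x y ≤ 0) :
    hillEstar α ≤ hillE α x y vx vy := by
  have h0 : 0 < α := by linarith
  have hpos : 0 < x ^ 2 + y ^ 2 := by
    by_contra hh
    apply hxy
    have hx : x = 0 := by nlinarith [sq_nonneg x, sq_nonneg y]
    have hy : y = 0 := by nlinarith [sq_nonneg x, sq_nonneg y]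
    rw [hx, hy]
  have hr : 0 < hillR x y := Real.sqrt_pos.2 hpos
  have hrs : hillR x y ^ 2 = x ^ 2 + y ^ 2 := Real.sq_sqrt hpos.le
  obtain ⟨e1, e2⟩ := hill_r0 α hα
  have hs0 : 0 < α ^ (1 / (α + 2)) := by positivity
  have hc : 0 < α ^ (-(α / (α + 2))) := by positivity
  unfold hillEstar hillE hillV
  unfold hillK at hK
  unfold hillW at hK hW
  set r := hillR x y
  set c := α ^ (-(α / (α + 2)))
  set s := α ^ (1 / (α + 2))
  have hR : 0 < r ^ α := by positivity
  have hdiv : ∀ a : ℝ, a / r ^ α = a * (r ^ α)⁻¹ := fun a => div_eq_mul_inv _ _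
  rw [hdiv] at hK hW ⊢
  set u := (r ^ α)⁻¹ with hu
  have hu0 : 0 < u := by positivity
  have hn2 : Real.sqrt (vx ^ 2 + vy ^ 2) ^ 2 = vx ^ 2 + vy ^ 2 := Real.sq_sqrt (by positivity)
  have hn := Real.sqrt_nonneg (vx ^ 2 + vy ^ 2)
  set n := Real.sqrt (vx ^ 2 + vy ^ 2)
  have hm : x * vy - vx * y ≤ r * n := by
    apply le_of_sq_le_sq _ (by positivity)
    rw [mul_pow, hrs, hn2]
    nlinarith [sq_nonneg (x * vx + y * vy)]
  -- Bernoulli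
  have hσ : r ^ 2 / (α * c) = (r / s) ^ 2 := by rw [div_pow, e2]
  have hT : c / u = (r / s) ^ α := by
    rw [Real.div_rpow hr.le hs0.le, e1, hu]
    field_simp
  have hT2 : c / u = (r ^ 2 / (α * c)) ^ (α / 2) := by
    rw [hT, hσ, ← Real.rpow_natCast, ← Real.rpow_mul (by positivity)]
    congr 1; push_cast; ring
  have hber : 1 + (α / 2) * (r ^ 2 / (α * c) - 1) ≤ c / u := by
    have := one_add_mul_self_le_rpow_one_add (s := r ^ 2 / (α * c) - 1) (p := α / 2)
      (by have : 0 ≤ r ^ 2 / (α * c) := by positivity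
          linarith) (by linarith)
    rw [hT2]
    simpa using this
  have main := hill_core α r c n (-((α + 2) * (x ^ 2 - α * u))) (u / c - 1)
    (1 - r ^ 2 / (α * c)) hα hr hc hn (by linarith) (by field_simp; ring) ?_ ?_ ?_ ?_
  · have : c * (u / c - 1) = u - c := by field_simp
    rw [this, hn2] at main
    linarith
  · intro h
    have h1 : c / u ≤ 1 := by
      rw [div_le_one hu0]
      have : 1 ≤ u / c := by linarith
      rwa [one_le_div hc] at this
    by_contra hh
    have : 1 < (r ^ 2 / (α * c)) ^ (α / 2) := Real.one_lt_rpow (by linarith) (by linarith)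
    linarith
  · have := mul_le_mul_of_nonneg_right hber (by positivity : 0 ≤ u / c)
    have e : c / u * (u / c) = 1 := by field_simp
    rw [e] at this
    linarith
  · have : α * c * (1 + (u / c - 1)) = α * u := by field_simp; ring
    rw [this, hrs]
    nlinarith [sq_nonneg y]
  · linarith

/-- for α ≥ 2, inf{E : K ≥ 0, W ≤ 0} = inf{E : K = 0, W = 0} = E*. -/
theorem hill_variational_characterization (α : ℝ) (hα : 2 ≤ α) :
    IsGLB {e : ℝ | ∃ x y vx vy : ℝ, (x, y) ≠ (0, 0) ∧ 0 ≤ hillK α x y vx vy ∧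
        hillW α x y ≤ 0 ∧ e = hillE α x y vx vy} (hillEstar α) ∧
    IsGLB {e : ℝ | ∃ x y vx vy : ℝ, (x, y) ≠ (0, 0) ∧ hillK α x y vx vy = 0 ∧
        hillW α x y = 0 ∧ e = hillE α x y vx vy} (hillEstar α) := by
  have hmem : ∃ x y vx vy : ℝ, (x, y) ≠ (0, 0) ∧ hillK α x y vx vy = 0 ∧
        hillW α x y = 0 ∧ hillEstar α = hillE α x y vx vy := by
    have h0 : 0 < α := by linarith
    obtain ⟨e1, e2⟩ := hill_r0 α hα
    have hs0 : 0 < α ^ (1 / (α + 2)) := by positivity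
    have hR : hillR (α ^ (1 / (α + 2))) 0 = α ^ (1 / (α + 2)) := by
      unfold hillR
      rw [zero_pow two_ne_zero, add_zero, Real.sqrt_sq hs0.le]
    have hW : hillW α (α ^ (1 / (α + 2))) 0 = 0 := by
      unfold hillW
      rw [hR, e1, e2, div_inv_eq_mul, sub_self, mul_zero]
    refine ⟨α ^ (1 / (α + 2)), 0, 0, 0, ?_, ?_, hW, ?_⟩
    · intro h
      exact hs0.ne' (Prod.mk.inj h).1
    · unfold hillK
      rw [hW]; ring
    · unfold hillEstar hillE hillV
      rw [hR, e1, e2, div_inv_eq_mul]; ring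
  constructor
  · apply IsLeast.isGLB
    refine ⟨?_, ?_⟩
    · obtain ⟨x, y, vx, vy, h, hK, hW, hE⟩ := hmem
      exact ⟨x, y, vx, vy, h, hK.ge, hW.le, hE⟩
    · rintro e ⟨x, y, vx, vy, h, hK, hW, rfl⟩
      exact hill_lower α x y vx vy hα h hK hW
  · apply IsLeast.isGLB
    refine ⟨hmem, ?_⟩
    rintro e ⟨x, y, vx, vy, h, hK, hW, rfl⟩
    exact hill_lower α x y vx vy hα h hK.ge hW.le
end

section
/- Fix a real parameter α ≥ 2. If a phase point Γ = (x,y,ẋ,ẏ) ∈ ℝ⁴ with (x,y) ≠ (0,0) satisfies E(Γ) < E* and W(Γ) ≤ 0, then K(Γ) < 0. Equivalently, the set {Γ : E(Γ) < E*, K(Γ) ≥ 0, W(Γ) ≤ 0} is empty. -/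
open Real Set Filter Topology ENNReal

lemma hill_aux_s5 (k q : ℝ) (hk : 1 ≤ k) (hq : 0 < q) (hq1 : q ≤ 1) :
    0 ≤ (k - 1) * q ^ (-k) - 2 * k * q + k + 1 ∧
    2 * k * q * (k * q + q ^ (-k) - k - 1) ≤
      (k + 1) * ((k - 1) * q ^ (-k) - 2 * k * q + k + 1) ^ 2 := by
  have hB : 1 + k * (1 - q) ≤ q ^ (-k) := by
    have h := one_add_mul_self_le_rpow_one_add (s := q⁻¹ - 1) (p := k)
      (by have := inv_pos.2 hq; linarith) hk
    rw [add_sub_cancel, Real.inv_rpow hq.le, ← Real.rpow_neg hq.le] at h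
    have h2 : 1 - q ≤ q⁻¹ - 1 := by
      have : q * q⁻¹ = 1 := mul_inv_cancel₀ hq.ne'
      nlinarith [sq_nonneg (q - 1), inv_pos.2 hq, sq_nonneg (q⁻¹ - 1)]
    nlinarith
  -- upper bound
  have hU : q * q ^ (-k) - 1 ≤ (k - 1) * (1 - q) * q ^ (-k) := by
    have hlog := Real.add_one_le_exp ((k - 1) * Real.log q)
    have hl2 := Real.one_sub_inv_le_log_of_pos hq
    have e1 : Real.exp ((k - 1) * Real.log q) = q ^ (k - 1) := by
      rw [Real.rpow_def_of_pos hq, mul_comm]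
    have e2 : q ^ (k - 1) * q ^ (-k) = q⁻¹ := by
      rw [← Real.rpow_add hq, ← Real.rpow_neg_one]; congr 1; ring
    rw [e1] at hlog
    have h3 : 1 + (k - 1) * (1 - q⁻¹) ≤ q ^ (k - 1) := by nlinarith
    have hp : 0 < q ^ (-k) := Real.rpow_pos_of_pos hq _
    have h4 := mul_le_mul_of_nonneg_right h3 hp.le
    rw [e2] at h4
    have h5 := mul_le_mul_of_nonneg_left h4 hq.le
    have h6 : q * q⁻¹ = 1 := mul_inv_cancel₀ hq.ne'
    have h7 : q * ((1 + (k - 1) * (1 - q⁻¹)) * q ^ (-k))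
        = q * q ^ (-k) + (k - 1) * (q - q * q⁻¹) * q ^ (-k) := by ring
    rw [h7, h6] at h5
    linarith
  generalize q ^ (-k) = p at *
  obtain ⟨e, rfl⟩ : ∃ e, p = 1 + k * (1 - q) + e := ⟨p - (1 + k * (1 - q)), by ring⟩
  obtain ⟨d, rfl⟩ : ∃ d, q = 1 - d := ⟨1 - q, by ring⟩
  obtain ⟨m, rfl⟩ : ∃ m, k = 1 + m := ⟨k - 1, by ring⟩
  have he : 0 ≤ e := by linarith
  have hd : 0 ≤ d := by linarith
  have hm : 0 ≤ m := by linarith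
  have hK : (1 - d) * e ≤ (1 + m) ^ 2 * d ^ 2 + m * d * e := by nlinarith
  constructor
  · have : 0 ≤ (m + 2) * (m + 1) * d + m * e := by positivity
    linarith
  · have h1 : 2 * (1 + m) * ((1 - d) * e) ≤
        2 * (1 + m) * ((1 + m) ^ 2 * d ^ 2 + m * d * e) :=
      mul_le_mul_of_nonneg_left hK (by positivity)
    have h2 : 2 * (1 + m) * ((1 + m) ^ 2 * d ^ 2 + m * d * e) ≤
        (m + 2) * ((m + 2) * (m + 1) * d + m * e) ^ 2 := by
      rw [← sub_nonneg]
      ring_nf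
      positivity
    linarith

/-- for α ≥ 2, if E(Γ) < E* and W(Γ) ≤ 0 then K(Γ) < 0; that is, the set
{E < E*, K ≥ 0, W ≤ 0} is empty. -/
theorem hill_K_negative_below_ground_state (α : ℝ) (hα : 2 ≤ α)
    (x y vx vy : ℝ) (hxy : (x, y) ≠ (0, 0))
    (hE : hillE α x y vx vy < hillEstar α) (hW : hillW α x y ≤ 0) :
    hillK α x y vx vy < 0 := by
  have hR : 0 < x ^ 2 + y ^ 2 := by
    rcases eq_or_ne x 0 with h | h
    · have : y ≠ 0 := fun h' => hxy (by rw [h, h'])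
      positivity
    · positivity
  obtain ⟨k, rfl⟩ : ∃ k, α = 2 * k := ⟨α / 2, by ring⟩
  have hk : 1 ≤ k := by linarith
  have hα0 : 0 < 2 * k := by linarith
  unfold hillE hillV hillEstar at hE
  unfold hillW at hW
  unfold hillK hillW
  by_contra! hK
  have hr : (hillR x y) ^ (2 * k) = (x ^ 2 + y ^ 2) ^ k := by
    unfold hillR
    rw [Real.rpow_mul (Real.sqrt_nonneg _)]
    congr 1
    rw [Real.rpow_two, Real.sq_sqrt hR.le]
  rw [hr] at hE hW hK
  have hc : 0 < (2 * k) ^ (-(2 * k / (2 * k + 2))) := Real.rpow_pos_of_pos hα0 _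
  have hcc : (2 * k * (2 * k) ^ (-(2 * k / (2 * k + 2)))) ^ (-k)
      = (2 * k) ^ (-(2 * k / (2 * k + 2))) := by
    have : 2 * k * (2 * k) ^ (-(2 * k / (2 * k + 2))) = (2 * k) ^ (1 + -(2 * k / (2 * k + 2))) := by
      rw [Real.rpow_add hα0, Real.rpow_one]
    rw [this, ← Real.rpow_mul hα0.le]
    congr 1
    field_simp
    ring
  generalize (2 * k) ^ (-(2 * k / (2 * k + 2))) = c at *
  obtain ⟨q, hq⟩ : ∃ q, q = (x ^ 2 + y ^ 2) / (2 * k * c) := ⟨_, rfl⟩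
  have hq0 : 0 < q := by rw [hq]; positivity
  have hRq : x ^ 2 + y ^ 2 = 2 * k * c * q := by rw [hq]; field_simp
  have hρ : ((x ^ 2 + y ^ 2) ^ k)⁻¹ = c * q ^ (-k) := by
    rw [← Real.rpow_neg hR.le, hRq, Real.mul_rpow (by positivity) hq0.le, hcc]
  rw [div_eq_mul_inv _ ((x ^ 2 + y ^ 2) ^ k), hρ] at hE hW hK
  have hW' : x ^ 2 ≤ 2 * k * (c * q ^ (-k)) := by
    by_contra! h
    have : 0 < (2 * k + 2) * (x ^ 2 - 2 * k * (c * q ^ (-k))) := by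
      apply _root_.mul_pos <;> linarith
    linarith
  rcases le_total q 1 with h1 | h1
  · obtain ⟨hA, hB⟩ := hill_aux_s5 k q hk hq0 h1
    generalize q ^ (-k) = p at *
    obtain ⟨L, hL⟩ : ∃ L, L = x * vy - vx * y := ⟨_, rfl⟩
    obtain ⟨S, hS⟩ : ∃ S, S = vx ^ 2 + vy ^ 2 := ⟨_, rfl⟩
    have hCS : L ^ 2 ≤ (x ^ 2 + y ^ 2) * S := by
      rw [hL, hS]; nlinarith [sq_nonneg (x * vx + y * vy)]
    rw [← hL, ← hS] at hK
    rw [← hS] at hE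
    have hx : x ^ 2 ≤ 2 * k * c * q := by rw [← hRq]; nlinarith [sq_nonneg y]
    rw [hRq] at hCS
    have hx2 : (2 * k + 2) * x ^ 2 ≤ (2 * k + 2) * (2 * k * c * q) :=
      mul_le_mul_of_nonneg_left hx (by linarith)
    have hSA : S < (2 * k + 2) * c * 2 * (k * q + p - k - 1) := by linarith
    have hLH : c * (2 * k + 2) * ((k - 1) * p - 2 * k * q + k + 1) < L := by linarith
    have hH0 : 0 ≤ c * (2 * k + 2) * ((k - 1) * p - 2 * k * q + k + 1) := by positivity
    have h3 : (c * (2 * k + 2) * ((k - 1) * p - 2 * k * q + k + 1)) ^ 2 < L ^ 2 :=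
      pow_lt_pow_left₀ hLH hH0 (by norm_num)
    have h4 : 2 * k * c * q * S ≤ 2 * k * c * q * ((2 * k + 2) * c * 2 * (k * q + p - k - 1)) :=
      mul_le_mul_of_nonneg_left hSA.le (by positivity)
    have h5 := mul_le_mul_of_nonneg_left hB (show 0 ≤ 4 * c ^ 2 * (k + 1) by positivity)
    linarith
  · have hp : q ^ (-k) ≤ 1 := Real.rpow_le_one_of_one_le_of_nonpos h1 (by linarith)
    have h2 : c * q ^ (-k) ≤ c := by nlinarith
    generalize c * q ^ (-k) = ρ at *
    have h3 : (2 * k + 2) * x ^ 2 ≤ (2 * k + 2) * (2 * k * ρ) :=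
      mul_le_mul_of_nonneg_left hW' (by linarith)
    have h4 : (2 * k + 2) ^ 2 * ρ ≤ (2 * k + 2) ^ 2 * c :=
      mul_le_mul_of_nonneg_left h2 (by positivity)
    nlinarith [sq_nonneg vx, sq_nonneg vy]
end

section
/- Fix a real parameter α > 2. There exists a constant c > 0 such that every phase point Γ = (x,y,ẋ,ẏ) ∈ ℝ⁴ with (x,y) ≠ (0,0) satisfying E(Γ) < 1 and |K(Γ)| < c has r = √(x² + y²) ≥ c. -/
open Real Set Filter Topology ENNReal

/-- for α > 2 there is c > 0 such that E(Γ) < 1 and |K(Γ)| < c force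
r = √(x² + y²) ≥ c. -/
theorem hill_away_from_singularity_strong (α : ℝ) (hα : 2 < α) :
    ∃ c > 0, ∀ x y vx vy : ℝ, (x, y) ≠ (0, 0) →
      hillE α x y vx vy < 1 → |hillK α x y vx vy| < c → c ≤ hillR x y := by
  obtain ⟨d, hd⟩ : ∃ d, d = (α - 2) / 4 := ⟨_, rfl⟩
  have hd0 : 0 < d := by rw [hd]; linarith
  obtain ⟨M, hM⟩ : ∃ M, M = (1 + d) * (α + 4) + 1 / d + (α + 2) := ⟨_, rfl⟩
  have hdi : 0 < 1 / d := by positivity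
  have hM0 : 0 < M := by rw [hM]; positivity
  have hA : 0 < (α + 2) * (2 * d) := by positivity
  refine ⟨min 1 ((α + 2) * (2 * d) / (M + 1)), lt_min one_pos (by positivity), ?_⟩
  intro x y vx vy hne hE hK
  by_contra! hr
  have hr1 := lt_of_lt_of_le hr (min_le_left _ _)
  have hr2 := lt_of_lt_of_le hr (min_le_right _ _)
  have hK1 := lt_of_lt_of_le hK (min_le_left _ _)
  have hsq : 0 < x ^ 2 + y ^ 2 := by
    by_contra! h
    apply hne
    have hx : x = 0 := by nlinarith [sq_nonneg x, sq_nonneg y]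
    have hy : y = 0 := by nlinarith [sq_nonneg x, sq_nonneg y]
    rw [hx, hy]
  have hr0 : 0 < hillR x y := Real.sqrt_pos.mpr hsq
  have hrr : hillR x y ^ 2 = x ^ 2 + y ^ 2 := Real.sq_sqrt hsq.le
  unfold hillK hillW at hK1
  unfold hillE hillV at hE
  generalize hillR x y = r at *
  have hP : 1 / r ≤ 1 / r ^ α := by
    apply one_div_le_one_div_of_le (Real.rpow_pos_of_pos hr0 _)
    simpa using Real.rpow_le_rpow_of_exponent_ge hr0 hr1.le (by linarith : (1 : ℝ) ≤ α)
  rw [div_eq_mul_one_div (α + 2) (r ^ α)] at hE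
  rw [div_eq_mul_one_div α (r ^ α)] at hK1
  generalize 1 / r ^ α = P at *
  have hAP : M + 1 < (α + 2) * (2 * d) * P := by
    rw [lt_div_iff₀ (by linarith)] at hr2
    have h1 : M + 1 < (α + 2) * (2 * d) * (1 / r) := by
      rw [mul_one_div, lt_div_iff₀ hr0]; linarith
    exact lt_of_lt_of_le h1 (mul_le_mul_of_nonneg_left hP hA.le)
  have hs1 : x ^ 2 + y ^ 2 ≤ 1 := by rw [← hrr]; nlinarith
  have hx1 : x ^ 2 ≤ 1 := by nlinarith [sq_nonneg y]
  have hcross : 2 * (x * vy - vx * y) ≥ -(d * (vx ^ 2 + vy ^ 2) + 1 / d) ∧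
      2 * (x * vy - vx * y) ≤ d * (vx ^ 2 + vy ^ 2) + 1 / d := by
    have e : (x ^ 2 + y ^ 2) * (1 / d) ≤ 1 * (1 / d) := mul_le_mul_of_nonneg_right hs1 hdi.le
    have e1 : 0 ≤ ((d * vy - x) ^ 2 + (d * vx + y) ^ 2) / d := by positivity
    have e2 : 0 ≤ ((d * vy + x) ^ 2 + (d * vx - y) ^ 2) / d := by positivity
    have f1 : ((d * vy - x) ^ 2 + (d * vx + y) ^ 2) / d = d * (vx ^ 2 + vy ^ 2)
      + (x ^ 2 + y ^ 2) * (1 / d) - 2 * (x * vy - vx * y) := by field_simp; ring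
    have f2 : ((d * vy + x) ^ 2 + (d * vx - y) ^ 2) / d = d * (vx ^ 2 + vy ^ 2)
      + (x ^ 2 + y ^ 2) * (1 / d) + 2 * (x * vy - vx * y) := by field_simp; ring
    constructor <;> linarith
  have hK2 := (abs_lt.mp hK1).1
  have hax : (α + 2) * x ^ 2 ≤ (α + 2) * 1 := mul_le_mul_of_nonneg_left hx1 (by linarith)
  have hv : vx ^ 2 + vy ^ 2 ≤ (α + 4) + 2 * (α + 2) * P := by linarith
  have hv2 : (1 + d) * (vx ^ 2 + vy ^ 2) ≤ (1 + d) * ((α + 4) + 2 * (α + 2) * P) :=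
    mul_le_mul_of_nonneg_left hv (by linarith)
  have hα' : α = 4 * d + 2 := by linarith
  have key : (1 + d) * ((α + 4) + 2 * (α + 2) * P) - (α + 2) * (α * P)
      = (1 + d) * (α + 4) - (α + 2) * (2 * d) * P := by rw [hα']; ring
  have h3 := hcross.2
  linarith
end

section
/- Fix a real parameter α ≥ 2. For every δ > 0 there exists κ(δ) > 0 such that every phase point Γ = (x,y,ẋ,ẏ) ∈ ℝ⁴ with (x,y) ≠ (0,0) satisfying E(Γ) ≤ E* − δ and W(Γ) ≤ 0 has |K(Γ)| ≥ κ(δ). -/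
open Real Set Filter Topology ENNReal

theorem hill_aux_alg (α p q : ℝ) (hα : 2 ≤ α) (hp : 1 ≤ p) (hq : 0 < q)
    (h : α * q * p ≤ 2 + (α - 2) * p) :
    4 * α * q * (2 * p + α * q - (α + 2)) ≤
      (α + 2) * ((α - 2) * p - 2 * α * q + α + 2) ^ 2 := by
  have hq1 : q ≤ 1 := by
    by_contra hc
    push Not at hc
    have : 0 < α * p * (q - 1) := by
      have : 0 < q - 1 := by linarith
      positivity
    nlinarith
  have hP : 0 ≤ p - 1 := by linarith
  have hQ : 0 ≤ 1 - q := by linarith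
  -- first consequence of the Bernoulli inequality
  have h1 : 2 * (p - 1) - α * (1 - q) ≤ α * (1 - q) * (p - 1) := by nlinarith
  have h2 : 4 * α * q * (2 * p + α * q - (α + 2)) ≤
      4 * α * q * (α * (1 - q) * (p - 1)) := by
    apply mul_le_mul_of_nonneg_left _ (by positivity)
    linarith
  have h3 : α * q * (p - 1) ≤ (α + 2) * (α * (1 - q) + (α - 2) * (p - 1)) := by
    have hp0 : 0 < p := by linarith
    have hA : α * q * (p - 1) ≤ α * (1 - q) + (α - 2) * (p - 1) := by
      have hh := mul_le_mul_of_nonneg_right h hP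
      have e1 : (α * q * (p - 1)) * p ≤ (α * (1 - q) + (α - 2) * (p - 1)) * p := by
        nlinarith
      exact le_of_mul_le_mul_right e1 hp0
    have hB : 0 ≤ α * (1 - q) + (α - 2) * (p - 1) := by
      have : 0 ≤ α - 2 := by linarith
      positivity
    nlinarith
  have h4 : 4 * α * q * (α * (1 - q) * (p - 1)) ≤
      4 * α * (1 - q) * ((α + 2) * (α * (1 - q) + (α - 2) * (p - 1))) := by
    have : 0 ≤ 4 * α * (1 - q) := by positivity
    nlinarith [mul_le_mul_of_nonneg_left h3 this]
  have h5 : 0 ≤ (α + 2) * ((α - 2) * (p - 1)) ^ 2 := by positivity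
  have h6 : 0 ≤ 4 * α * (1 - q) * ((α + 2) * ((α - 2) * (p - 1))) := by
    have : 0 ≤ α - 2 := by linarith
    positivity
  nlinarith

theorem hill_aux_pow (α r : ℝ) (hα : 2 ≤ α) (hr : 0 < r)
    (hp : α ^ (-(α / (α + 2))) ≤ 1 / r ^ α) :
    α * (r ^ 2 / (α * α ^ (-(α / (α + 2))))) * ((1 / r ^ α) / α ^ (-(α / (α + 2)))) ≤
      2 + (α - 2) * ((1 / r ^ α) / α ^ (-(α / (α + 2)))) := by
  have hα0 : 0 < α := by linarith
  set a := α ^ (-(α / (α + 2))) with ha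
  have ha0 : 0 < a := Real.rpow_pos_of_pos hα0 _
  have hra : 0 < r ^ α := Real.rpow_pos_of_pos hr _
  set p := (1 / r ^ α) / a with hpd
  have hp1 : 1 ≤ p := by rw [hpd, le_div_iff₀ ha0]; linarith
  have hp0 : 0 < p := by linarith
  have e1 : (r ^ α) ^ (2 / α) = r ^ 2 := by
    rw [← Real.rpow_mul hr.le, ← Real.rpow_natCast]
    congr 1
    push_cast
    field_simp
  have e2 : a ^ (2 / α) * (α * a) = 1 := by
    have : α * a = α ^ (1 + -(α / (α + 2))) := by
      rw [Real.rpow_add hα0, Real.rpow_one]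
    rw [this, ha, ← Real.rpow_mul hα0.le, ← Real.rpow_add hα0]
    have : -(α / (α + 2)) * (2 / α) + (1 + -(α / (α + 2))) = 0 := by
      field_simp
      ring
    rw [this, Real.rpow_zero]
  have e3 : p ^ (2 / α) = α * a / r ^ 2 := by
    rw [hpd, Real.div_rpow (by positivity) ha0.le, Real.div_rpow (by norm_num) hra.le, e1,
      Real.one_rpow]
    have : 0 < a ^ (2 / α) := Real.rpow_pos_of_pos ha0 _
    field_simp
    linarith
  have e4 : p ^ (1 - 2 / α) = p * (r ^ 2 / (α * a)) := by
    rw [Real.rpow_sub hp0, Real.rpow_one, e3]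
    field_simp
  have hb : 2 / α ≤ 1 := by rw [div_le_one hα0]; exact hα
  have hb0 : 0 < 2 / α := by positivity
  have e5 := rpow_one_add_le_one_add_mul_self (s := p - 1) (by linarith)
    (p := 1 - 2 / α) (by linarith) (by linarith)
  rw [show 1 + (p - 1) = p by ring, e4] at e5
  have e6 := mul_le_mul_of_nonneg_left e5 hα0.le
  have e7 : α * (1 + (1 - 2 / α) * (p - 1)) = 2 + (α - 2) * p := by
    field_simp
    ring
  rw [e7] at e6
  linarith

set_option maxHeartbeats 1000000 in
/-- for α ≥ 2 and any δ > 0 there is κ(δ) > 0 such that E(Γ) ≤ E* − δ and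
W(Γ) ≤ 0 force |K(Γ)| ≥ κ(δ). -/
theorem hill_K_uniformly_bounded_below (α : ℝ) (hα : 2 ≤ α) :
    ∀ δ > (0 : ℝ), ∃ κ > (0 : ℝ), ∀ x y vx vy : ℝ, (x, y) ≠ (0, 0) →
      hillE α x y vx vy ≤ hillEstar α - δ → hillW α x y ≤ 0 →
        κ ≤ |hillK α x y vx vy| := by
  intro δ hδ
  refine ⟨2 * δ, by linarith, ?_⟩
  intro x y vx vy hxy hE hW
  have hα0 : 0 < α := by linarith
  have hpos : 0 < x ^ 2 + y ^ 2 := by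
    rcases (by positivity : 0 ≤ x ^ 2 + y ^ 2).lt_or_eq with h | h
    · exact h
    · exfalso
      apply hxy
      have hx : x = 0 := by nlinarith [sq_nonneg x, sq_nonneg y]
      have hy : y = 0 := by nlinarith [sq_nonneg x, sq_nonneg y]
      rw [hx, hy]
  have hr : 0 < hillR x y := Real.sqrt_pos.2 hpos
  have hr2 : hillR x y ^ 2 = x ^ 2 + y ^ 2 := Real.sq_sqrt hpos.le
  have key := hill_aux_pow α (hillR x y) hα hr
  unfold hillK
  unfold hillE hillV hillEstar at hE
  unfold hillW at hW ⊢
  generalize hillR x y = r at *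
  have ha0 : 0 < α ^ (-(α / (α + 2))) := Real.rpow_pos_of_pos hα0 _
  generalize α ^ (-(α / (α + 2))) = a at *
  have hra : 0 < r ^ α := Real.rpow_pos_of_pos hr _
  rw [div_eq_mul_one_div α (r ^ α)] at hW ⊢
  rw [div_eq_mul_one_div (α + 2) (r ^ α)] at hE
  have hu0 : 0 < 1 / r ^ α := by positivity
  generalize 1 / r ^ α = u at *
  have hW' : x ^ 2 ≤ α * u := by
    by_contra hc
    push Not at hc
    have : 0 < (α + 2) * (x ^ 2 - α * u) := mul_pos (by linarith) (by linarith)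
    linarith
  have hua : a ≤ u := by
    by_contra hc
    push Not at hc
    have h1 : 0 < (α + 2) ^ 2 * (a - u) := mul_pos (by positivity) (by linarith)
    nlinarith [sq_nonneg vx, sq_nonneg vy]
  have key := key hua
  have hq0 : 0 < r ^ 2 / (α * a) := by positivity
  have hp1 : 1 ≤ u / a := by rw [le_div_iff₀ ha0]; linarith
  have alg := hill_aux_alg α (u / a) (r ^ 2 / (α * a)) hα hp1 hq0 key
  have hR : r ^ 2 = r ^ 2 / (α * a) * (α * a) := by field_simp
  have hU : u = u / a * a := by field_simp
  have hq1 : r ^ 2 / (α * a) ≤ 1 := by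
    by_contra hc
    push Not at hc
    have h1 : 0 < α * (u / a) * (r ^ 2 / (α * a) - 1) :=
      mul_pos (mul_pos hα0 (by linarith)) (by linarith)
    nlinarith
  generalize u / a = p at *
  generalize r ^ 2 / (α * a) = q at *
  rw [hr2] at hR
  have hv : vx ^ 2 + vy ^ 2 ≤ (α + 2) * a * (2 * p + α * q - (α + 2)) - 2 * δ := by
    have : (α + 2) * x ^ 2 ≤ (α + 2) * (q * (α * a)) :=
      mul_le_mul_of_nonneg_left (by nlinarith [sq_nonneg y]) (by linarith)
    subst hU
    linarith
  have hB0 : 0 ≤ (α + 2) * a * ((α - 2) * p - 2 * α * q + α + 2) := by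
    apply mul_nonneg (by positivity)
    nlinarith [mul_nonneg (sub_nonneg.2 hα) (sub_nonneg.2 hp1),
      mul_nonneg hα0.le (sub_nonneg.2 hq1)]
  have hL : (2 * (x * vy - vx * y)) ^ 2 ≤
      ((α + 2) * a * ((α - 2) * p - 2 * α * q + α + 2)) ^ 2 := by
    calc (2 * (x * vy - vx * y)) ^ 2 ≤ 4 * (x ^ 2 + y ^ 2) * (vx ^ 2 + vy ^ 2) := by
          nlinarith [sq_nonneg (x * vx + y * vy)]
      _ ≤ 4 * (x ^ 2 + y ^ 2) * ((α + 2) * a * (2 * p + α * q - (α + 2))) :=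
          mul_le_mul_of_nonneg_left (by linarith) (by positivity)
      _ = (α + 2) * a ^ 2 * (4 * α * q * (2 * p + α * q - (α + 2))) := by
          rw [hR]; ring
      _ ≤ (α + 2) * a ^ 2 * ((α + 2) * ((α - 2) * p - 2 * α * q + α + 2) ^ 2) :=
          mul_le_mul_of_nonneg_left alg (by positivity)
      _ = _ := by ring
  have hL' := abs_le_of_sq_le_sq hL hB0
  have hX : (α + 2) * (x ^ 2 - α * u) ≤ (α + 2) * (q * (α * a) - α * u) :=
    mul_le_mul_of_nonneg_left (by nlinarith [sq_nonneg y]) (by linarith)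
  have hK : vx ^ 2 + vy ^ 2 + 2 * (x * vy - vx * y) + (α + 2) * (x ^ 2 - α * u) ≤ -(2 * δ) := by
    have hL2 := (abs_le.1 hL').2
    subst hU
    linarith
  rw [le_abs]
  right
  linarith
end

section
/- Fix a real parameter α > 0. Let r₀ > 0 be defined by r₀^{α+2} = α and r₁ > 0 by r₁^{α+2} = α(α+2)², and set E(Γ₀) = −(α+2)²/(2 r₀^α) and E(Γ₁) = −(α+2)³/(4 r₁^α). Then E(Γ₀) < E(Γ₁) < 0. Equivalently, f(α) := E(Γ₁)/E(Γ₀) = ½ (α+2)^{(2−α)/(α+2)} satisfies 0 < f(α) < 1 for all α > 0. -/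
open Real

/-- with r₀^{α+2} = α and r₁^{α+2} = α(α+2)², the energies
E(Γ₀) = −(α+2)²/(2r₀^α) and E(Γ₁) = −(α+2)³/(4r₁^α) satisfy E(Γ₀) < E(Γ₁) < 0;
equivalently f(α) = ½(α+2)^{(2−α)/(α+2)} satisfies 0 < f(α) < 1. -/
theorem hill_energy_comparison_Gamma0_Gamma1 (α r₀ r₁ : ℝ) (hα : 0 < α)
    (hr₀ : 0 < r₀) (hr₁ : 0 < r₁)
    (h₀ : r₀ ^ (α + 2) = α) (h₁ : r₁ ^ (α + 2) = α * (α + 2) ^ 2) :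
    (-(α + 2) ^ 2 / (2 * r₀ ^ α) < -(α + 2) ^ 3 / (4 * r₁ ^ α) ∧
      -(α + 2) ^ 3 / (4 * r₁ ^ α) < 0) ∧
    (0 < (1 / 2) * (α + 2) ^ ((2 - α) / (α + 2)) ∧
      (1 / 2) * (α + 2) ^ ((2 - α) / (α + 2)) < 1) := by
  have hx : 0 < α + 2 := by linarith
  have key : (2 - α) * Real.log (α + 2) < (α + 2) * Real.log 2 := by
    have hl2 : 0.6931471803 < Real.log 2 := Real.log_two_gt_d9
    have hL : Real.log (α + 2) ≤ Real.log 2 + α / 2 := by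
      have h := Real.log_le_sub_one_of_pos (show 0 < (α + 2) / 2 by linarith)
      rw [Real.log_div hx.ne' (by norm_num)] at h
      linarith
    have hL0 : 0 < Real.log (α + 2) := Real.log_pos (by linarith)
    rcases le_or_gt 2 α with h | h
    · have h1 : (2 - α) * Real.log (α + 2) ≤ 0 :=
        mul_nonpos_of_nonpos_of_nonneg (by linarith) hL0.le
      have h2 : 0 < (α + 2) * Real.log 2 := by positivity
      linarith
    · have h1 := mul_le_mul_of_nonneg_left hL (show 0 ≤ 2 - α by linarith)
      have h2 : 0 < α * (2 * Real.log 2 - (2 - α) / 2) := mul_pos hα (by linarith)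
      nlinarith
  have l0 : (α + 2) * Real.log r₀ = Real.log α := by
    rw [← Real.log_rpow hr₀, h₀]
  have l1 : (α + 2) * Real.log r₁ = Real.log α + 2 * Real.log (α + 2) := by
    rw [← Real.log_rpow hr₁, h₁, Real.log_mul hα.ne' (by positivity), Real.log_pow]
    norm_num
  have p0 : 0 < r₀ ^ α := Real.rpow_pos_of_pos hr₀ α
  have p1 : 0 < r₁ ^ α := Real.rpow_pos_of_pos hr₁ α
  have main : (α + 2) * r₀ ^ α < 2 * r₁ ^ α := by
    rw [← Real.log_lt_log_iff (by positivity) (by positivity),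
      Real.log_mul hx.ne' p0.ne', Real.log_mul (by norm_num) p1.ne',
      Real.log_rpow hr₀, Real.log_rpow hr₁]
    refine lt_of_mul_lt_mul_left ?_ hx.le
    have e0 : (α + 2) * (α * Real.log r₀) = α * Real.log α := by rw [← l0]; ring
    have e1 : (α + 2) * (α * Real.log r₁) = α * (Real.log α + 2 * Real.log (α + 2)) := by
      rw [← l1]; ring
    rw [mul_add, mul_add, e0, e1]
    linarith
  refine ⟨⟨?_, ?_⟩, by positivity, ?_⟩
  · rw [div_lt_div_iff₀ (by positivity) (by positivity)]
    have := mul_lt_mul_of_pos_left main (show 0 < 2 * (α + 2) ^ 2 by positivity)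
    linarith
  · exact div_neg_of_neg_of_pos (neg_neg_of_pos (by positivity)) (by positivity)
  · have : (α + 2) ^ ((2 - α) / (α + 2)) < 2 := by
      rw [← Real.log_lt_log_iff (by positivity) (by norm_num), Real.log_rpow hx,
        div_mul_eq_mul_div, div_lt_iff₀ hx]
      linarith
    linarith
end

section
/- Fix a real parameter α > 2. Let r₁ > 0 be defined by r₁^{α+2} = α(α+2)² and r₂ > 0 by r₂^{α+2} = α(α+2)(α−2)/4, and set E(Γ₁) = −(α+2)³/(4 r₁^α) and E(Γ₂±) = ((α+2)²/(8 r₂^α)) · [α(1 ± √((α−2)/(α+2)))² − 8/(α+2)]. Then E(Γ₂−) < 0 < E(Γ₂+) and E(Γ₁) < E(Γ₂−). -/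
open Real

/-- for α > 2, with r₁^{α+2} = α(α+2)² and r₂^{α+2} = α(α+2)(α−2)/4, the
energies E(Γ₁) = −(α+2)³/(4r₁^α) and
E(Γ₂±) = ((α+2)²/(8r₂^α))·[α(1 ± √((α−2)/(α+2)))² − 8/(α+2)]
satisfy E(Γ₂−) < 0 < E(Γ₂+) and E(Γ₁) < E(Γ₂−). -/
theorem hill_energy_comparison_Gamma1_Gamma2 (α r₁ r₂ : ℝ) (hα : 2 < α)
    (hr₁ : 0 < r₁) (hr₂ : 0 < r₂)
    (h₁ : r₁ ^ (α + 2) = α * (α + 2) ^ 2)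
    (h₂ : r₂ ^ (α + 2) = α * (α + 2) * (α - 2) / 4) :
    ((α + 2) ^ 2 / (8 * r₂ ^ α) *
        (α * (1 - Real.sqrt ((α - 2) / (α + 2))) ^ 2 - 8 / (α + 2)) < 0 ∧
      0 < (α + 2) ^ 2 / (8 * r₂ ^ α) *
        (α * (1 + Real.sqrt ((α - 2) / (α + 2))) ^ 2 - 8 / (α + 2))) ∧
    -(α + 2) ^ 3 / (4 * r₁ ^ α) <
      (α + 2) ^ 2 / (8 * r₂ ^ α) *
        (α * (1 - Real.sqrt ((α - 2) / (α + 2))) ^ 2 - 8 / (α + 2)) := by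
  have ha : 0 < α + 2 := by linarith
  have hb : 0 < α - 2 := by linarith
  obtain ⟨s, hs⟩ : ∃ s, s = Real.sqrt ((α - 2) / (α + 2)) := ⟨_, rfl⟩
  rw [← hs]
  have hs0 : 0 < s := by rw [hs]; positivity
  have hsq : s ^ 2 = (α - 2) / (α + 2) := by rw [hs, Real.sq_sqrt (by positivity)]
  have hs2 : s ^ 2 < 1 := by rw [hsq, div_lt_one ha]; linarith
  have hs1 : s < 1 := by nlinarith
  have hm : 0 < 1 - s := by linarith
  have hp : 0 < 1 + s := by linarith
  have hmp : 0 < 1 - s ^ 2 := by linarith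
  have hsq' : s ^ 2 * (α + 2) = α - 2 := by rw [hsq]; field_simp
  have ha4 : α + 2 = 4 / (1 - s ^ 2) := by
    rw [eq_div_iff hmp.ne']; linarith
  have h8 : 8 / (α + 2) = 2 * (1 - s ^ 2) := by
    rw [ha4]; field_simp; norm_num
  have hαs : α = 2 * (1 + s ^ 2) / (1 - s ^ 2) := by
    rw [eq_div_iff hmp.ne']; linarith
  have hfac : 1 - s ^ 2 = (1 - s) * (1 + s) := by ring
  have eM : α * (1 - s) ^ 2 - 8 / (α + 2) = -(4 * s * (1 - s) / (1 + s)) := by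
    rw [h8, hαs, hfac]; field_simp; ring
  have eP : α * (1 + s) ^ 2 - 8 / (α + 2) = 4 * s * (1 + s) / (1 - s) := by
    rw [h8, hαs, hfac]; field_simp; ring
  rw [eM, eP]
  have hR1 : 0 < r₁ ^ α := Real.rpow_pos_of_pos hr₁ _
  have hR2 : 0 < r₂ ^ α := Real.rpow_pos_of_pos hr₂ _
  refine ⟨⟨?_, by positivity⟩, ?_⟩
  · have : 0 < (α + 2) ^ 2 / (8 * r₂ ^ α) * (4 * s * (1 - s) / (1 + s)) := by positivity
    linarith
  have hq : 0 < r₂ / r₁ := by positivity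
  have hqp : (r₂ / r₁) ^ (α + 2) = (s / 2) ^ 2 := by
    rw [Real.div_rpow hr₂.le hr₁.le, h₁, h₂, div_pow, hsq]
    field_simp
    norm_num
  have hlog : (α + 2) * Real.log (r₂ / r₁) = 2 * Real.log (s / 2) := by
    rw [← Real.log_rpow hq, hqp, Real.log_pow]; norm_num
  have hlog2 : Real.log (r₂ / r₁) * α = Real.log (s / 2) + s ^ 2 * Real.log (s / 2) := by
    have h3 : Real.log (r₂ / r₁) = (1 - s ^ 2) / 2 * Real.log (s / 2) := by
      rw [ha4] at hlog
      field_simp at hlog ⊢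
      linarith
    rw [h3, hαs]; field_simp
  have hx : 0 < s / 2 := by positivity
  have hl : -(2 / s - 1) ≤ Real.log (s / 2) := by
    have := Real.one_sub_inv_le_log_of_pos hx
    rw [inv_div] at this
    linarith
  have hl2 : -s + -s < s ^ 2 * Real.log (s / 2) := by
    have h5 := mul_le_mul_of_nonneg_left hl (sq_nonneg s)
    have h6 : s ^ 2 * -(2 / s - 1) = -2 * s + s ^ 2 := by field_simp; ring
    nlinarith [sq_pos_of_pos hs0]
  have hexp : (1 - s) ^ 2 < Real.exp (s ^ 2 * Real.log (s / 2)) := by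
    have h7 := Real.exp_lt_exp.mpr hl2
    rw [Real.exp_add] at h7
    have h8 := Real.add_one_le_exp (-s)
    nlinarith
  have key : s / 2 * (1 - s) ^ 2 < r₂ ^ α / r₁ ^ α := by
    rw [← Real.div_rpow hr₂.le hr₁.le, Real.rpow_def_of_pos hq, hlog2, Real.exp_add,
      Real.exp_log hx]
    exact mul_lt_mul_of_pos_left hexp hx
  rw [lt_div_iff₀ hR1] at key
  have e1 : (α + 2) ^ 2 / (8 * r₂ ^ α) * -(4 * s * (1 - s) / (1 + s))
      - -(α + 2) ^ 3 / (4 * r₁ ^ α)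
      = (α + 2) ^ 3 / (4 * r₁ ^ α * r₂ ^ α) * (r₂ ^ α - s / 2 * (1 - s) ^ 2 * r₁ ^ α) := by
    have e2 : s * (1 - s) / (1 + s) = (α + 2) * (s * (1 - s) ^ 2) / 4 := by
      rw [ha4, hfac]; field_simp
    have e3 : 4 * s * (1 - s) / (1 + s) = (α + 2) * (s * (1 - s) ^ 2) := by
      have : 4 * s * (1 - s) / (1 + s) = 4 * (s * (1 - s) / (1 + s)) := by ring
      rw [this, e2]; ring
    rw [e3]; field_simp; ring
  have : 0 < (α + 2) ^ 3 / (4 * r₁ ^ α * r₂ ^ α) * (r₂ ^ α - s / 2 * (1 - s) ^ 2 * r₁ ^ α) :=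
    mul_pos (by positivity) (by linarith)
  linarith
end

section
/- Fix a real parameter α ≥ 2. The sets 𝒲̃₋⁻ = {Γ ∈ ℝ⁴ : E(Γ) = E*, K(Γ) < 0, W(Γ) ≤ 0} and 𝒲̃₊ = {Γ ∈ ℝ⁴ : E(Γ) = E*, W(Γ) > 0} are invariant under the flow of Hill's lunar equations: if a solution has its phase point in one of these sets at time 0, it remains in that set for all times in its maximal interval of existence. -/
open Real Set Filter Topology ENNReal

lemma hillR_rpow (x y a : ℝ) : (hillR x y) ^ a = (x ^ 2 + y ^ 2) ^ (a / 2) := by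
  unfold hillR
  rw [Real.sqrt_eq_rpow, ← Real.rpow_mul (by positivity)]
  congr 1; ring

lemma R0_pow (α : ℝ) (hα : 2 ≤ α) : (α ^ (2 / (α + 2))) ^ (α / 2) = α / α ^ (2 / (α + 2)) := by
  have h0 : 0 < α := by linarith
  rw [← Real.rpow_mul h0.le, _root_.eq_div_iff (by positivity), ← Real.rpow_add h0]
  have : 2 / (α + 2) * (α / 2) + 2 / (α + 2) = 1 := by field_simp
  rw [this, Real.rpow_one]

lemma R0_pow' (α : ℝ) (hα : 2 ≤ α) : (α ^ (2 / (α + 2))) ^ ((α + 2) / 2) = α := by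
  have h0 : 0 < α := by linarith
  rw [← Real.rpow_mul h0.le]
  have : 2 / (α + 2) * ((α + 2) / 2) = 1 := by field_simp
  rw [this, Real.rpow_one]

lemma Estar_eq (α : ℝ) (hα : 2 ≤ α) :
    hillEstar α = -(1 / 2) * (α + 2) ^ 2 * (α ^ (2 / (α + 2)) / α) := by
  have h0 : 0 < α := by linarith
  unfold hillEstar
  congr 1
  rw [_root_.eq_div_iff h0.ne']
  have h1 : 2 / (α + 2) = -(α / (α + 2)) + 1 := by field_simp; ring
  rw [h1, Real.rpow_add h0, Real.rpow_one]

lemma s_le (α : ℝ) (hα : 2 ≤ α) (s : ℝ) (hs : 0 < s)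
    (h : α ^ (2 / (α + 2)) ≤ α / s ^ (α / 2)) : s ≤ α ^ (2 / (α + 2)) := by
  have h0 : 0 < α := by linarith
  by_contra hc
  push Not at hc
  have h1 : (α ^ (2 / (α + 2))) ^ (α / 2) < s ^ (α / 2) :=
    Real.rpow_lt_rpow (by positivity) hc (by positivity)
  rw [R0_pow α hα] at h1
  have hR : 0 < α ^ (2 / (α + 2)) := by positivity
  have hS : 0 < s ^ (α / 2) := by positivity
  rw [div_lt_iff₀ hR] at h1
  rw [le_div_iff₀ hS] at h
  nlinarith

lemma bern (α : ℝ) (hα : 2 ≤ α) (s : ℝ) (hs : 0 < s) :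
    s * (α / s ^ (α / 2)) ≤ (α ^ (2 / (α + 2))) ^ 2 +
      (1 - 2 / α) * α ^ (2 / (α + 2)) * (α / s ^ (α / 2) - α ^ (2 / (α + 2))) := by
  have h0 : 0 < α := by linarith
  have hp := R0_pow α hα
  set R := α ^ (2 / (α + 2)) with hR'
  have hR : 0 < R := by positivity
  set P := α / s ^ (α / 2) with hP'
  have hP : 0 < P := by positivity
  have hq : P / R = (s / R) ^ (-(α / 2)) := by
    rw [Real.rpow_neg (by positivity), Real.div_rpow hs.le hR.le, hp, hP']
    have hS : 0 < s ^ (α / 2) := by positivity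
    field_simp
  have hz : (P / R) ^ (1 - 2 / α) = (s / R) * (P / R) := by
    rw [sub_eq_add_neg, Real.rpow_add (by positivity), Real.rpow_one, mul_comm]
    congr 1
    rw [hq, ← Real.rpow_mul (by positivity)]
    have : -(α / 2) * -(2 / α) = 1 := by field_simp
    rw [this, Real.rpow_one]
  have hm : 2 / α ≤ 1 := by rw [div_le_one h0]; exact hα
  have hm' : 0 < 2 / α := by positivity
  have hb := _root_.rpow_one_add_le_one_add_mul_self (s := P / R - 1) (p := 1 - 2 / α)
    (by have : 0 < P / R := by positivity
        linarith) (by linarith) (by linarith)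
  rw [add_sub_cancel, hz] at hb
  have e1 : s * P = R ^ 2 * (s / R * (P / R)) := by field_simp
  have e2 : R ^ 2 + (1 - 2 / α) * R * (P - R) = R ^ 2 * (1 + (1 - 2 / α) * (P / R - 1)) := by
    field_simp
  rw [e1, e2]
  exact mul_le_mul_of_nonneg_left hb (by positivity)

lemma E_eq (α : ℝ) (hα : 2 ≤ α) (x y u v : ℝ) (h : hillE α x y u v = hillEstar α) :
    u ^ 2 + v ^ 2 = (α + 2) * (x ^ 2 + 2 / α * (α / (x ^ 2 + y ^ 2) ^ (α / 2))
      - (1 + 2 / α) * α ^ (2 / (α + 2))) := by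
  have h0 : 0 < α := by linarith
  rw [Estar_eq α hα] at h
  unfold hillE hillV at h
  rw [hillR_rpow] at h
  have e1 : 2 / α * (α / (x ^ 2 + y ^ 2) ^ (α / 2)) = 2 * (1 / (x ^ 2 + y ^ 2) ^ (α / 2)) := by
    field_simp
  have e2 : (1 + 2 / α) = (α + 2) * (1 / α) := by field_simp
  rw [e1, e2]
  rw [div_eq_mul_one_div (α + 2), div_eq_mul_one_div _ α] at h
  linear_combination 2 * h

lemma W_zero (α : ℝ) (hα : 2 ≤ α) (x y u v : ℝ) (hxy : 0 < x ^ 2 + y ^ 2)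
    (h : hillE α x y u v = hillEstar α) (hW : hillW α x y = 0) :
    x ^ 2 = α ^ (2 / (α + 2)) ∧ y = 0 ∧ u = 0 ∧ v = 0 := by
  have h0 : 0 < α := by linarith
  have hE := E_eq α hα x y u v h
  unfold hillW at hW
  rw [hillR_rpow] at hW
  have hs := s_le α hα _ hxy
  set P := α / (x ^ 2 + y ^ 2) ^ (α / 2)
  set R := α ^ (2 / (α + 2))
  have hXP : x ^ 2 = P := by
    rcases mul_eq_zero.1 hW with h | h <;> linarith
  have hE2 : u ^ 2 + v ^ 2 = ((α + 2) * (1 + 2 / α)) * (P - R) := by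
    rw [hE, hXP]; ring
  have hpos : 0 < (α + 2) * (1 + 2 / α) := by positivity
  have hPR : R ≤ P := by
    have : 0 ≤ ((α + 2) * (1 + 2 / α)) * (P - R) := by rw [← hE2]; positivity
    have := nonneg_of_mul_nonneg_right this hpos
    linarith
  have hsR := hs hPR
  have hy : y = 0 := by
    have : y ^ 2 ≤ 0 := by linarith
    exact pow_eq_zero_iff (two_ne_zero) |>.1 (le_antisymm this (sq_nonneg y))
  have hX : x ^ 2 = R := by
    have := sq_nonneg y
    linarith
  have : P = R := by linarith
  rw [this, sub_self, mul_zero] at hE2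
  refine ⟨hX, hy, ?_, ?_⟩ <;> nlinarith [sq_nonneg u, sq_nonneg v]

lemma K_neg (α : ℝ) (hα : 2 ≤ α) (x y u v : ℝ) (hxy : 0 < x ^ 2 + y ^ 2)
    (h : hillE α x y u v = hillEstar α) (hW : hillW α x y < 0) :
    hillK α x y u v < 0 := by
  have h0 : 0 < α := by linarith
  have hE := E_eq α hα x y u v h
  unfold hillK
  unfold hillW at hW ⊢
  rw [hillR_rpow] at hW ⊢
  have hs := s_le α hα _ hxy
  have hb := bern α hα _ hxy
  have hR : 0 < α ^ (2 / (α + 2)) := by positivity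
  have hXs : x ^ 2 ≤ x ^ 2 + y ^ 2 := by nlinarith [sq_nonneg y]
  have hcs : (x * v - u * y) ^ 2 ≤ (x ^ 2 + y ^ 2) * (u ^ 2 + v ^ 2) := by
    nlinarith [sq_nonneg (x * u + y * v)]
  have hV : 0 ≤ u ^ 2 + v ^ 2 := by positivity
  generalize hL : x * v - u * y = L at *
  generalize hVV : u ^ 2 + v ^ 2 = V at *
  generalize hss : x ^ 2 + y ^ 2 = s at *
  generalize α / s ^ (α / 2) = P at *
  generalize α ^ (2 / (α + 2)) = R at *
  generalize x ^ 2 = X at *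
  have hm : 2 / α ≤ 1 := by rw [div_le_one h0]; exact hα
  have hm' : 0 < 2 / α := by positivity
  generalize 2 / α = m at *
  have ha : 0 < α + 2 := by linarith
  have hXP : X < P := by
    by_contra hc
    push Not at hc
    have := mul_nonneg ha.le (sub_nonneg.2 hc)
    linarith
  have hI : 0 ≤ X + m * P - (1 + m) * R := by
    rw [hE] at hV
    exact nonneg_of_mul_nonneg_right hV ha
  have hPR : R < P := by nlinarith
  have hsR := hs hPR.le
  -- key inequality
  have hsR' : s < R := by
    rcases hsR.lt_or_eq with h | h
    · exact h
    · rw [h] at hb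
      exfalso
      nlinarith [mul_pos (mul_pos hm' hR) (sub_pos.2 hPR)]
  set p := P - R with hp
  set A := R - s with hA
  have hp0 : 0 < p := by linarith
  have hA0 : 0 < A := by linarith
  have hB : 0 ≤ (1 - m) * p := mul_nonneg (by linarith) hp0.le
  have k1 : s * p ≤ R * (A + (1 - m) * p) := by
    have : P = p + R := by ring
    rw [this] at hb
    nlinarith
  have k2 : R * (m * p - A) ≤ A * p := by
    have : s = R - A := by ring
    rw [this] at k1
    nlinarith
  have k3 : s * (m * p - A) ≤ A * (A + (1 - m) * p) := by
    have c1 := mul_le_mul_of_nonneg_left k2 hxy.le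
    have c2 := mul_le_mul_of_nonneg_left k1 hA0.le
    have : R * (s * (m * p - A)) ≤ R * (A * (A + (1 - m) * p)) := by nlinarith
    exact le_of_mul_le_mul_left this hR
  have k4 : s * (X + m * P - (1 + m) * R) ≤ s * (m * p - A) := by
    apply mul_le_mul_of_nonneg_left _ hxy.le
    rw [hp, hA]; nlinarith
  set D := (1 - m) * P + (1 + m) * R - 2 * X with hD
  have hDge : (1 - m) * p + 2 * A ≤ D := by rw [hp, hA, hD]; nlinarith
  have hDpos : 0 < D := by linarith
  have k5 : s * (X + m * P - (1 + m) * R) < D ^ 2 := by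
    have : ((1 - m) * p + 2 * A) ^ 2 ≤ D ^ 2 := by
      apply pow_le_pow_left₀ (by positivity) hDge
    have e := mul_nonneg hB hA0.le
    have e' := mul_pos hA0 hA0
    generalize (1 - m) * p = B at *
    have e2 := sq_nonneg B
    have e3 : (B + 2 * A) ^ 2 = B ^ 2 + 4 * (B * A) + 4 * (A * A) := by ring
    have e4 : A * (A + B) = A * A + B * A := by ring
    linarith
  have k6 : 4 * (s * V) < ((α + 2) * D) ^ 2 := by
    rw [hE]
    have c1 : 4 * (s * ((α + 2) * (X + m * P - (1 + m) * R))) < 4 * (α + 2) * D ^ 2 := by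
      have := mul_lt_mul_of_pos_left k5 (by positivity : 0 < 4 * (α + 2))
      linarith
    have c2 : 4 * (α + 2) * D ^ 2 ≤ (α + 2) * (α + 2) * D ^ 2 := by
      gcongr; linarith
    have c3 : ((α + 2) * D) ^ 2 = (α + 2) * (α + 2) * D ^ 2 := by ring
    linarith
  have hG : V + 2 * L + (α + 2) * (X - P) = 2 * L - (α + 2) * D := by
    rw [hE, hD]; ring
  rw [hG]
  have : 2 * L < (α + 2) * D := by
    apply lt_of_pow_lt_pow_left₀ 2 (by positivity)
    have : (2 * L) ^ 2 = 4 * L ^ 2 := by ring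
    linarith
  linarith

lemma dom_mono {T : ℝ≥0∞} {t s : ℝ} (ht : t ∈ hillDomain T) (hs : s ∈ Icc 0 t) :
    s ∈ hillDomain T :=
  ⟨hs.1, lt_of_le_of_lt (ENNReal.ofReal_le_ofReal hs.2) ht.2⟩

lemma s_pos {x y : ℝ} (h : (x, y) ≠ (0, 0)) : 0 < x ^ 2 + y ^ 2 := by
  by_contra hc
  push Not at hc
  apply h
  have hx : x = 0 := by nlinarith [sq_nonneg x, sq_nonneg y]
  have hy : y = 0 := by nlinarith [sq_nonneg x, sq_nonneg y]
  rw [hx, hy]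

lemma E_deriv {α : ℝ} {T : ℝ≥0∞} {x y : ℝ → ℝ} (h : HillSolOn α x y T) {t : ℝ}
    (ht : t ∈ hillDomain T) :
    HasDerivAt (fun t => hillE α (x t) (y t) (deriv x t) (deriv y t)) 0 t := by
  obtain ⟨hne, hx, hy, hvx, hvy⟩ := h t ht
  have hs := s_pos hne
  have hfun : (fun t => hillE α (x t) (y t) (deriv x t) (deriv y t)) =
      fun t => (1 / 2) * (deriv x t ^ 2 + deriv y t ^ 2) +
        (-((α + 2) / 2) * x t ^ 2 - (α + 2) * (x t ^ 2 + y t ^ 2) ^ (-(α / 2))) := by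
    funext t
    unfold hillE hillV
    rw [hillR_rpow, Real.rpow_neg (by positivity), div_eq_mul_inv (α + 2) (_ ^ _)]
  rw [hfun]
  have hsd := ((hx.pow 2).add (hy.pow 2)).rpow_const (p := -(α / 2)) (Or.inl hs.ne')
  have := (((hvx.pow 2).add (hvy.pow 2)).const_mul (1 / 2)).add
    (((hx.pow 2).const_mul (-((α + 2) / 2))).sub (hsd.const_mul (α + 2)))
  refine HasDerivAt.congr_deriv this ?_
  unfold hillVx hillVy
  have e : (x t ^ 2 + y t ^ 2) ^ (-(α / 2) - 1) = ((x t ^ 2 + y t ^ 2) ^ ((α + 2) / 2))⁻¹ := by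
    rw [← Real.rpow_neg hs.le]; congr 1; ring
  simp only [hillR_rpow, Pi.add_apply, Pi.pow_apply]
  rw [e]
  generalize (x t ^ 2 + y t ^ 2) ^ ((α + 2) / 2) = Q
  push_cast
  ring

lemma E_const {α : ℝ} {T : ℝ≥0∞} {x y : ℝ → ℝ} (h : HillSolOn α x y T) {t : ℝ}
    (ht : t ∈ hillDomain T) :
    hillE α (x t) (y t) (deriv x t) (deriv y t) =
      hillE α (x 0) (y 0) (deriv x 0) (deriv y 0) := by
  refine constant_of_has_deriv_right_zero (a := 0) (b := t)
    (f := fun t => hillE α (x t) (y t) (deriv x t) (deriv y t)) ?_ ?_ t ⟨ht.1, le_rfl⟩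
  · intro s hs
    exact (E_deriv h (dom_mono ht hs)).continuousAt.continuousWithinAt
  · intro s hs
    exact (E_deriv h (dom_mono ht ⟨hs.1, hs.2.le⟩)).hasDerivWithinAt

/-- A trajectory reaching an equilibrium was there from the start. -/
lemma equil_back {α : ℝ} (hα : 2 ≤ α) {T : ℝ≥0∞} {x y : ℝ → ℝ} (h : HillSolOn α x y T) {t₁ : ℝ}
    (ht : t₁ ∈ hillDomain T) (hx1 : x t₁ ^ 2 = α ^ (2 / (α + 2))) (hy1 : y t₁ = 0)
    (hu1 : deriv x t₁ = 0) (hv1 : deriv y t₁ = 0) : x 0 = x t₁ ∧ y 0 = y t₁ := by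
  have h0 : 0 < α := by linarith
  set R := α ^ (2 / (α + 2)) with hRd
  have hR : 0 < R := by positivity
  set φ : ℝ → ℝ := fun s => α / s ^ ((α + 2) / 2) with hφ
  have hφR : φ R = 1 := by
    simp only [hφ, hRd]
    rw [R0_pow' α hα, div_self h0.ne']
  have hφd : ∀ s, 0 < s → DifferentiableAt ℝ φ s := by
    intro s hs
    have h1 : DifferentiableAt ℝ (fun s : ℝ => s ^ ((α + 2) / 2)) s :=
      ((hasDerivAt_id s).rpow_const (Or.inl hs.ne')).differentiableAt
    exact (differentiableAt_const α).div h1 (by positivity)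
  have hds : ContinuousOn (dslope φ R) (Ioi 0) :=
    (continuousOn_dslope (Ioi_mem_nhds hR)).2
      ⟨fun s hs => (hφd s hs).continuousAt.continuousWithinAt, hφd R hR⟩
  have hsp : ∀ t ∈ Icc 0 t₁, 0 < x t ^ 2 + y t ^ 2 := fun t h' => s_pos (h t (dom_mono ht h')).1
  have hxc : ContinuousOn x (Icc 0 t₁) := fun t h' =>
    (h t (dom_mono ht h')).2.1.continuousAt.continuousWithinAt
  have hyc : ContinuousOn y (Icc 0 t₁) := fun t h' =>
    (h t (dom_mono ht h')).2.2.1.continuousAt.continuousWithinAt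
  have hsc : ContinuousOn (fun t => x t ^ 2 + y t ^ 2) (Icc 0 t₁) := (hxc.pow 2).add (hyc.pow 2)
  have hcc : ContinuousOn (fun t => dslope φ R (x t ^ 2 + y t ^ 2)) (Icc 0 t₁) :=
    hds.comp hsc hsp
  have hφc : ContinuousOn (fun t => φ (x t ^ 2 + y t ^ 2)) (Icc 0 t₁) :=
    ContinuousOn.comp (g := φ) (t := Ioi 0)
      (fun s hs => (hφd s hs).continuousAt.continuousWithinAt) hsc hsp
  obtain ⟨x₀, hx₀⟩ : ∃ x₀, x₀ = x t₁ := ⟨_, rfl⟩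
  rw [← hx₀] at hx1 ⊢
  rw [hy1]
  -- coefficients of the linear system
  set b1 : ℝ → ℝ := fun t =>
    -(α + 2) * x t * dslope φ R (x t ^ 2 + y t ^ 2) * (x t + x₀) with hb1
  set b2 : ℝ → ℝ := fun t =>
    -(α + 2) * x t * dslope φ R (x t ^ 2 + y t ^ 2) * y t with hb2
  set b3 : ℝ → ℝ := fun t => -(α + 2) * φ (x t ^ 2 + y t ^ 2) with hb3
  have hb1c : ContinuousOn b1 (Icc 0 t₁) :=
    ((continuousOn_const.mul hxc).mul hcc).mul (hxc.add continuousOn_const)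
  have hb2c : ContinuousOn b2 (Icc 0 t₁) := ((continuousOn_const.mul hxc).mul hcc).mul hyc
  have hb3c : ContinuousOn b3 (Icc 0 t₁) := continuousOn_const.mul hφc
  obtain ⟨C1, hC1⟩ := isCompact_Icc.exists_bound_of_continuousOn hb1c
  obtain ⟨C2, hC2⟩ := isCompact_Icc.exists_bound_of_continuousOn hb2c
  obtain ⟨C3, hC3⟩ := isCompact_Icc.exists_bound_of_continuousOn hb3c
  have hax : ∀ t ∈ Icc 0 t₁, 2 * deriv y t - hillVx α (x t) (y t) =
      2 * deriv y t + b1 t * (x t - x₀) + b2 t * y t := by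
    intro t _
    have hd := sub_smul_dslope φ R (x t ^ 2 + y t ^ 2)
    rw [hφR, smul_eq_mul, ← hx1] at hd
    unfold hillVx
    rw [hillR_rpow]
    simp only [hb1, hb2]
    have e : (α + 2) * α * x t / (x t ^ 2 + y t ^ 2) ^ ((α + 2) / 2) =
        (α + 2) * x t * φ (x t ^ 2 + y t ^ 2) := by
      simp only [hφ]; ring
    rw [e, ← hx1]
    linear_combination (α + 2) * x t * hd
  have hay : ∀ t ∈ Icc 0 t₁, -(2 * deriv x t) - hillVy α (x t) (y t) =
      -(2 * deriv x t) + b3 t * y t := by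
    intro t _
    unfold hillVy
    rw [hillR_rpow]
    simp only [hb3, hφ]
    ring
  set C := 1 + |C1| + |C2| + |C3| + 1 with hC
  set f : ℝ → ℝ := fun t => (x t - x₀) ^ 2 + y t ^ 2 + deriv x t ^ 2 + deriv y t ^ 2 with hf
  have hfd : ∀ t ∈ Icc 0 t₁, HasDerivAt (fun t => f t * Real.exp (C * t))
      ((2 * (x t - x₀) * deriv x t + 2 * y t * deriv y t
        + 2 * deriv x t * (b1 t * (x t - x₀) + b2 t * y t) + 2 * deriv y t * (b3 t * y t)
        + C * f t) * Real.exp (C * t)) t := by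
    intro t h'
    obtain ⟨-, hx, hy, hvx, hvy⟩ := h t (dom_mono ht h')
    rw [hax t h'] at hvx
    rw [hay t h'] at hvy
    have hex : HasDerivAt (fun t => Real.exp (C * t)) (Real.exp (C * t) * (C * 1)) t :=
      ((hasDerivAt_id t).const_mul C).exp
    have := (((((hx.sub_const x₀).pow 2).add (hy.pow 2)).add (hvx.pow 2)).add (hvy.pow 2)).mul hex
    refine HasDerivAt.congr_deriv this ?_
    simp only [hf, Pi.add_apply, Pi.pow_apply]
    push_cast
    ring
  have hmono : MonotoneOn (fun t => f t * Real.exp (C * t)) (Icc 0 t₁) := by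
    apply monotoneOn_of_deriv_nonneg (convex_Icc 0 t₁)
    · exact fun t h' => (hfd t h').continuousAt.continuousWithinAt
    · exact fun t h' => (hfd t (interior_subset h')).differentiableAt.differentiableWithinAt
    · intro t h'
      have h' := interior_subset h'
      rw [(hfd t h').deriv]
      apply mul_nonneg _ (Real.exp_pos _).le
      have c1 := (hC1 t h').trans (le_abs_self _)
      have c2 := (hC2 t h').trans (le_abs_self _)
      have c3 := (hC3 t h').trans (le_abs_self _)
      rw [Real.norm_eq_abs] at c1 c2 c3
      have key : ∀ b B p q : ℝ, |b| ≤ B → 0 ≤ 2 * b * (p * q) + B * (p ^ 2 + q ^ 2) := by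
        intro b B p q hb
        obtain ⟨l, r⟩ := abs_le.1 hb
        nlinarith [mul_nonneg (by linarith : 0 ≤ B + b) (sq_nonneg (p + q)),
          mul_nonneg (by linarith : 0 ≤ B - b) (sq_nonneg (p - q))]
      have k1 := key _ _ (deriv x t) (x t - x₀) c1
      have k2 := key _ _ (deriv x t) (y t) c2
      have k3 := key _ _ (deriv y t) (y t) c3
      have k4 := key 1 1 (deriv x t) (x t - x₀) (by simp)
      have k5 := key 1 1 (deriv y t) (y t) (by simp)
      simp only [hf, hC]
      have a1 := abs_nonneg C1
      have a2 := abs_nonneg C2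
      have a3 := abs_nonneg C3
      have n1 := mul_nonneg a1 (add_nonneg (sq_nonneg (deriv y t)) (sq_nonneg (y t)))
      have n2 := mul_nonneg a2 (add_nonneg (sq_nonneg (deriv y t)) (sq_nonneg (x t - x₀)))
      have n3 := mul_nonneg a3 (add_nonneg (sq_nonneg (deriv x t)) (sq_nonneg (x t - x₀)))
      have n4 := sq_nonneg (deriv x t)
      have n5 := sq_nonneg (deriv y t)
      have n6 := sq_nonneg (x t - x₀)
      have n7 := sq_nonneg (y t)
      linarith
  have hle := hmono (left_mem_Icc.2 ht.1) (right_mem_Icc.2 ht.1) ht.1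
  simp only [hf, ← hx₀, hy1, hu1, hv1, mul_zero, Real.exp_zero] at hle
  have n4 := sq_nonneg (deriv x 0)
  have n5 := sq_nonneg (deriv y 0)
  have n6 := sq_nonneg (x 0 - x₀)
  have n7 := sq_nonneg (y 0)
  have hle : (x 0 - x₀) ^ 2 + y 0 ^ 2 + deriv x 0 ^ 2 + deriv y 0 ^ 2 ≤ 0 := by
    simpa using hle
  have p1 : (x 0 - x₀) ^ 2 = 0 := by linarith
  have p2 : (y 0) ^ 2 = 0 := by linarith
  exact ⟨sub_eq_zero.1 (pow_eq_zero_iff two_ne_zero |>.1 p1), pow_eq_zero_iff two_ne_zero |>.1 p2⟩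

lemma W_back {α : ℝ} (hα : 2 ≤ α) {T : ℝ≥0∞} {x y : ℝ → ℝ} (h : HillSolOn α x y T) {t₁ : ℝ}
    (ht : t₁ ∈ hillDomain T)
    (hE : hillE α (x 0) (y 0) (deriv x 0) (deriv y 0) = hillEstar α)
    (hW : hillW α (x t₁) (y t₁) = 0) : hillW α (x 0) (y 0) = 0 := by
  rw [← E_const h ht] at hE
  obtain ⟨a, b, c, d⟩ := W_zero α hα _ _ _ _ (s_pos (h t₁ ht).1) hE hW
  obtain ⟨e1, e2⟩ := equil_back hα h ht a b c d
  rw [e1, e2, hW]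

lemma W_cont {α : ℝ} {T : ℝ≥0∞} {x y : ℝ → ℝ} (h : HillSolOn α x y T) {t : ℝ}
    (ht : t ∈ hillDomain T) : ContinuousOn (fun t => hillW α (x t) (y t)) (Icc 0 t) := by
  intro s hs
  obtain ⟨hne, hx, hy, -, -⟩ := h s (dom_mono ht hs)
  have hp := s_pos hne
  have : ContinuousAt (fun t => (α + 2) * (x t ^ 2 - α / (x t ^ 2 + y t ^ 2) ^ (α / 2))) s := by
    have hc : ContinuousAt (fun t => (x t ^ 2 + y t ^ 2) ^ (α / 2)) s :=
      ((hx.continuousAt.pow 2).add (hy.continuousAt.pow 2)).rpow_const (Or.inl hp.ne')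
    have hne' : (x s ^ 2 + y s ^ 2) ^ (α / 2) ≠ 0 := (Real.rpow_pos_of_pos hp _).ne'
    exact continuousAt_const.mul ((hx.continuousAt.pow 2).sub (continuousAt_const.div hc hne'))
  have e : (fun t => hillW α (x t) (y t)) =
      (fun t => (α + 2) * (x t ^ 2 - α / (x t ^ 2 + y t ^ 2) ^ (α / 2))) := by
    funext t; unfold hillW; rw [hillR_rpow]
  rw [e]
  exact this.continuousWithinAt

/-- for α ≥ 2, the sets 𝒲̃₋⁻ = {E = E*, K < 0, W ≤ 0} and
𝒲̃₊ = {E = E*, W > 0} are invariant under the flow of Hill's lunar equations. -/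
theorem hill_at_ground_state_invariance
    (α : ℝ) (hα : 2 ≤ α) (Tmax : ℝ≥0∞) (hT : 0 < Tmax) (x y : ℝ → ℝ)
    (hsol : HillMaxSol α x y Tmax) :
    ((hillE α (x 0) (y 0) (deriv x 0) (deriv y 0) = hillEstar α ∧
        hillK α (x 0) (y 0) (deriv x 0) (deriv y 0) < 0 ∧
        hillW α (x 0) (y 0) ≤ 0) →
      ∀ t ∈ hillDomain Tmax,
        hillE α (x t) (y t) (deriv x t) (deriv y t) = hillEstar α ∧
          hillK α (x t) (y t) (deriv x t) (deriv y t) < 0 ∧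
          hillW α (x t) (y t) ≤ 0) ∧
    ((hillE α (x 0) (y 0) (deriv x 0) (deriv y 0) = hillEstar α ∧
        0 < hillW α (x 0) (y 0)) →
      ∀ t ∈ hillDomain Tmax,
        hillE α (x t) (y t) (deriv x t) (deriv y t) = hillEstar α ∧
          0 < hillW α (x t) (y t)) := by

  have h := hsol.1
  have hd0 : (0 : ℝ) ∈ hillDomain Tmax := ⟨le_rfl, by simpa using hT⟩
  constructor
  · rintro ⟨hE, hK, hW⟩ t ht
    have hEt := (E_const h ht).trans hE
    have hW0 : hillW α (x 0) (y 0) < 0 := by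
      rcases hW.lt_or_eq with h' | h'
      · exact h'
      · exfalso
        obtain ⟨-, b, c, d⟩ := W_zero α hα _ _ _ _ (s_pos (h 0 hd0).1) hE h'
        unfold hillK at hK
        rw [h', b, c, d] at hK
        norm_num at hK
    have hWt : hillW α (x t) (y t) < 0 := by
      by_contra hc
      push Not at hc
      obtain ⟨t₁, ht₁, h1⟩ := intermediate_value_Icc ht.1 (W_cont h ht) ⟨hW0.le, hc⟩
      exact hW0.ne (W_back hα h (dom_mono ht ht₁) hE h1)
    exact ⟨hEt, K_neg α hα _ _ _ _ (s_pos (h t ht).1) hEt hWt, hWt.le⟩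
  · rintro ⟨hE, hW0⟩ t ht
    refine ⟨(E_const h ht).trans hE, ?_⟩
    by_contra hc
    push Not at hc
    obtain ⟨t₁, ht₁, h1⟩ := intermediate_value_Icc' ht.1 (W_cont h ht) ⟨hc, hW0.le⟩
    exact hW0.ne' (W_back hα h (dom_mono ht ht₁) hE h1)
end
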